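/- Let (Λ_Q, f) be a C^{1+Lip} expansive and transitive Markov system. If t ≥ 0 is such that a t-conformal measure on Λ_Q exists, then the Hausdorff dimension of H is at most t; consequently dim_H H ≤ t_c. -/

import Mathlib

open Set Metric Filter MeasureTheory
open scoped Classical

/-- The word `[ω 0, ω 1, …, ω (n-1)]` read off from the sequence `ω`. -/
def wordOf {p : ℕ} (ω : ℕ → Fin p) (n : ℕ) : List (Fin p) :=
  (List.range n).map ω

/-- The cylinder sets `Δ_{i₁…iₙ} = g_{i₁…i_{n-1}}(I_{iₙ})` of the iterated function
system given by the big interval `I`, the subintervals `Isub i` and the maps `g i`;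
by convention `Δ_∅ = I`. -/
def cylOf {p : ℕ} (I : Set ℝ) (Isub : Fin p → Set ℝ) (g : Fin p → ℝ → ℝ) :
    List (Fin p) → Set ℝ
  | [] => I
  | [i] => Isub i
  | i :: j :: w => g i '' cylOf I Isub g (j :: w)

/-- The sequence `ω` contains the word `w` as a sub-word starting at position `n`. -/
def containsAt {p : ℕ} (ω : ℕ → Fin p) (w : List (Fin p)) (n : ℕ) : Prop :=
  ∀ k : ℕ, (hk : k < w.length) → ω (n + k) = w.get ⟨k, hk⟩

/-- The sequence `ω` belongs to `Σ_Q`, i.e. it contains no word of `Q` as a sub-word. -/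
def avoids {p : ℕ} (Q : Finset (List (Fin p))) (ω : ℕ → Fin p) : Prop :=
  ∀ w ∈ Q, ∀ n : ℕ, ¬ containsAt ω w n

/-- The limit set `Λ_Q = π(Σ_Q)`: points lying, for some `ω ∈ Σ_Q`, in all the
cylinders `Δ_{ω₀…ω_{n-1}}`. -/
def limitSetOf {p : ℕ} (I : Set ℝ) (Isub : Fin p → Set ℝ) (g : Fin p → ℝ → ℝ)
    (Q : Finset (List (Fin p))) : Set ℝ :=
  { x | ∃ ω : ℕ → Fin p, avoids Q ω ∧ ∀ n : ℕ, x ∈ cylOf I Isub g (wordOf ω n) }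

/-- `gIter g ω n = g_{i_n … i_1} = g_{ω (n-1)} ∘ ⋯ ∘ g_{ω 0}`. -/
def gIter {p : ℕ} (g : Fin p → ℝ → ℝ) (ω : ℕ → Fin p) : ℕ → ℝ → ℝ
  | 0 => id
  | n + 1 => g (ω n) ∘ gIter g ω n

/-- The derivative of the composition `gIter g ω n` at `x` (chain rule product). -/
noncomputable def gIterDer {p : ℕ} (g gder : Fin p → ℝ → ℝ) (ω : ℕ → Fin p)
    (n : ℕ) (x : ℝ) : ℝ :=
  ∏ k ∈ Finset.range n, gder (ω k) (gIter g ω k x)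

/-- Prepending the finite word `w` to the infinite sequence `ω`. -/
def prependWord {p : ℕ} (w : List (Fin p)) (ω : ℕ → Fin p) : ℕ → Fin p :=
  fun n => if h : n < w.length then w.get ⟨n, h⟩ else ω (n - w.length)

/-- `l(Σ_Q)`: the minimum, over all finite sets `Q'` of words with `Σ_{Q'} = Σ_Q`,
of the maximal length `l(Q')` of words of `Q'`. -/
noncomputable def minRepLen {p : ℕ} (Q : Finset (List (Fin p))) : ℕ :=
  sInf { n : ℕ | ∃ Q' : Finset (List (Fin p)),
    (∀ ω : ℕ → Fin p, avoids Q' ω ↔ avoids Q ω) ∧ Q'.sup List.length = n }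

/-- A `C^{1+Lip}` expansive and transitive Markov system `(Λ_Q, f)`. -/
structure ExpansiveMarkovSystem (p : ℕ) where
  /-- the alphabet is nonempty -/
  hp : 0 < p
  /-- the ambient closed interval `I` -/
  I : Set ℝ
  hI : ∃ a b : ℝ, a < b ∧ I = Set.Icc a b
  /-- the pairwise disjoint closed subintervals `I₁, …, I_p` -/
  Isub : Fin p → Set ℝ
  hIsub : ∀ i, ∃ a b : ℝ, a < b ∧ Isub i = Set.Icc a b
  hsubI : ∀ i, Isub i ⊆ I
  hdisj : ∀ i j, i ≠ j → Disjoint (Isub i) (Isub j)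
  /-- the contractions `g i`, defined on `⋃ j, Isub j` -/
  g : Fin p → ℝ → ℝ
  /-- the derivative of `g i` on `⋃ j, Isub j` -/
  gder : Fin p → ℝ → ℝ
  hg_inj : ∀ i, Set.InjOn (g i) (⋃ j, Isub j)
  hg_range : ∀ i, g i '' (⋃ j, Isub j) ⊆ interior (Isub i)
  hg_deriv : ∀ i, ∀ x ∈ ⋃ j, Isub j,
    HasDerivWithinAt (g i) (gder i x) (⋃ j, Isub j) x
  hgder_ne : ∀ i, ∀ x ∈ ⋃ j, Isub j, gder i x ≠ 0
  hgder_cont : ∀ i, ContinuousOn (gder i) (⋃ j, Isub j)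
  /-- `log |g i'|` is Lipschitz on the domain -/
  hgder_lip : ∀ i, ∃ θ : ℝ, ∀ x ∈ ⋃ j, Isub j, ∀ y ∈ ⋃ j, Isub j,
    abs (Real.log (abs (gder i x)) - Real.log (abs (gder i y))) ≤ θ * |x - y|
  /-- the expanding map `f`, with `f (g i x) = x` -/
  f : ℝ → ℝ
  /-- the derivative `f'` of `f` on the ranges of the `g i` -/
  fder : ℝ → ℝ
  hf : ∀ i, ∀ x ∈ ⋃ j, Isub j, f (g i x) = x
  hfder : ∀ i, ∀ x ∈ ⋃ j, Isub j, fder (g i x) = (gder i x)⁻¹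
  /-- the generator (expansivity) condition: `d_n → 0` -/
  hgen : ∀ ε : ℝ, 0 < ε → ∃ N : ℕ, ∀ w : List (Fin p), N ≤ w.length →
    Metric.diam (cylOf I Isub g w) < ε
  /-- the finite set of forbidden words -/
  Q : Finset (List (Fin p))
  /-- `Σ_Q` is completely invariant: `σ(Σ_Q) = Σ_Q` -/
  hQinv : ∀ ω : ℕ → Fin p, avoids Q ω →
    ∃ ω' : ℕ → Fin p, avoids Q ω' ∧ ∀ n : ℕ, ω' (n + 1) = ω n
  /-- `f|Λ_Q` is topologically transitive -/
  htrans : ∀ U V : Set ℝ, IsOpen U → IsOpen V →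
    (U ∩ limitSetOf I Isub g Q).Nonempty → (V ∩ limitSetOf I Isub g Q).Nonempty →
    ∃ n : ℕ, ∃ x ∈ U ∩ limitSetOf I Isub g Q, f^[n] x ∈ V

namespace ExpansiveMarkovSystem

variable {p : ℕ} (S : ExpansiveMarkovSystem p)

/-- The common domain `⋃ j, I_j` of the maps `g i`. -/
def dom : Set ℝ := ⋃ j, S.Isub j

/-- The cylinder `Δ_w` associated to the word `w`. -/
def cyl (w : List (Fin p)) : Set ℝ := cylOf S.I S.Isub S.g w

/-- The limit set `Λ_Q`. -/
def limitSet : Set ℝ := limitSetOf S.I S.Isub S.g S.Q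

/-- The domain of `f`, i.e. the union of the ranges of the `g i`. -/
def domF : Set ℝ := ⋃ i, S.g i '' S.dom

/-- The derivative `(fⁿ)'(x)` of the `n`-th iterate of `f` at `x`. -/
noncomputable def derIter (n : ℕ) (x : ℝ) : ℝ :=
  ∏ k ∈ Finset.range n, S.fder (S.f^[k] x)

/-- The Lyapunov exponent `χ(x) = limsup (1/n) log |(fⁿ)'(x)|`. -/
noncomputable def lyap (x : ℝ) : ℝ :=
  Filter.limsup (fun n : ℕ => Real.log |S.derIter n x| / n) Filter.atTop

/-- The set `H` of points of `Λ_Q` with infinitely many hyperbolic instants. -/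
def hypSet : Set ℝ :=
  { x ∈ S.limitSet | ∃ c₁ : ℝ, 0 < c₁ ∧ ∃ c₂ : ℝ, 0 < c₂ ∧
      ∃ n : ℕ → ℕ, StrictMono n ∧
        ∃ r : ℕ → ℝ, (∀ k, 0 < r k) ∧ Antitone r ∧
          Filter.Tendsto r Filter.atTop (nhds 0) ∧
          ∀ k : ℕ,
            (∀ y ∈ Metric.ball x (r k), ∀ j < n k, S.f^[j] y ∈ S.domF) ∧
            c₁ < Metric.diam (S.f^[n k] '' Metric.ball x (r k)) ∧
            (∀ y ∈ Metric.ball x (r k), ∀ z ∈ Metric.ball x (r k),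
              |S.derIter (n k) y| / |S.derIter (n k) z| < c₂) }

/-- `x` is a parabolic periodic point: `f^m(x) = x` and `|(f^m)'(x)| = 1`. -/
def IsParabolicPeriodic (x : ℝ) : Prop :=
  x ∈ S.limitSet ∧ ∃ m : ℕ, 1 ≤ m ∧ S.f^[m] x = x ∧ |S.derIter m x| = 1

/-- `ν` is a `t`-conformal (Borel probability) measure supported on `Λ_Q`. -/
def IsConformal (ν : Measure ℝ) (t : ℝ) : Prop :=
  IsProbabilityMeasure ν ∧ ν S.limitSetᶜ = 0 ∧
    ∀ A : Set ℝ, MeasurableSet A → A ⊆ S.limitSet → Set.InjOn S.f A →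
      ν (S.f '' A) = ∫⁻ x in A, ENNReal.ofReal (|S.fder x| ^ t) ∂ν

/-- `t_c = inf {t ≥ 0 : a t-conformal measure on Λ_Q exists}`. -/
noncomputable def tc : ℝ :=
  sInf { t : ℝ | 0 ≤ t ∧ ∃ ν : Measure ℝ, S.IsConformal ν t }

/-- `n` is a hyperbolic time for `x` with exponent `α`. -/
def IsHypTime (α : ℝ) (x : ℝ) (n : ℕ) : Prop :=
  ∀ k : ℕ, 1 ≤ k → k ≤ n → Real.exp (k * α) ≤ |S.derIter k (S.f^[n - k] x)|

/-- `H_HT(α)`: the points of `Λ_Q` with infinitely many hyperbolic times with exponent `α`. -/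
def HHT (α : ℝ) : Set ℝ :=
  { x ∈ S.limitSet | ∀ N : ℕ, ∃ n : ℕ, N ≤ n ∧ S.IsHypTime α x n }

end ExpansiveMarkovSystem

namespace ExpansiveMarkovSystem

variable {p : ℕ} (S : ExpansiveMarkovSystem p)

/-! ### Cylinders and inverse branches -/

/-- The inverse branch `g_{i₁} ∘ ⋯ ∘ g_{iₙ}` of `fⁿ` along the word `i₁ … iₙ`. -/
def branch : List (Fin p) → ℝ → ℝ
  | [] => id
  | i :: w => fun x => S.g i (branch w x)

/-- The derivative of the inverse branch along a word. -/
noncomputable def branchDer : List (Fin p) → ℝ → ℝ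
  | [] => fun _ => 1
  | i :: w => fun x => S.gder i (S.branch w x) * branchDer w x

/-- `ω` codes `x` if `x` lies in every cylinder given by a prefix of `ω`. -/
def IsCode (ω : ℕ → Fin p) (x : ℝ) : Prop :=
  ∀ n, x ∈ S.cyl (wordOf ω n)

/-- The one-sided shift on sequences. -/
def seqShift (ω : ℕ → Fin p) : ℕ → Fin p := fun n => ω (n + 1)

/-- Prepending one letter to a sequence. -/
def seqCons (i : Fin p) (ω : ℕ → Fin p) : ℕ → Fin p := fun n => Nat.casesOn n i ω

theorem cyl_cons (i : Fin p) {w : List (Fin p)} (hw : w ≠ []) :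
    S.cyl (i :: w) = S.g i '' S.cyl w := by
  cases w with
  | nil => exact absurd rfl hw
  | cons j w => rfl

theorem Isub_subset_dom (i : Fin p) : S.Isub i ⊆ S.dom := subset_iUnion _ i

theorem g_mem_Isub (i : Fin p) {x : ℝ} (hx : x ∈ S.dom) : S.g i x ∈ S.Isub i :=
  interior_subset (S.hg_range i ⟨x, hx, rfl⟩)

theorem g_mem_dom (i : Fin p) {x : ℝ} (hx : x ∈ S.dom) : S.g i x ∈ S.dom :=
  S.Isub_subset_dom i (S.g_mem_Isub i hx)

theorem f_g (i : Fin p) {x : ℝ} (hx : x ∈ S.dom) : S.f (S.g i x) = x := S.hf i x hx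

theorem cyl_cons_subset_Isub (i : Fin p) (w : List (Fin p)) : S.cyl (i :: w) ⊆ S.Isub i := by
  induction w generalizing i with
  | nil => exact subset_rfl
  | cons j w ih =>
    rw [S.cyl_cons i (List.cons_ne_nil _ _)]
    rintro _ ⟨y, hy, rfl⟩
    exact S.g_mem_Isub i (S.Isub_subset_dom j (ih j hy))

theorem cyl_subset_dom {w : List (Fin p)} (hw : w ≠ []) : S.cyl w ⊆ S.dom := by
  cases w with
  | nil => exact absurd rfl hw
  | cons i w => exact (S.cyl_cons_subset_Isub i w).trans (S.Isub_subset_dom i)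

theorem cyl_subset_I (w : List (Fin p)) : S.cyl w ⊆ S.I := by
  cases w with
  | nil => exact subset_rfl
  | cons i w => exact (S.cyl_cons_subset_Isub i w).trans (S.hsubI i)

theorem dom_subset_I : S.dom ⊆ S.I := iUnion_subset S.hsubI

theorem eq_of_mem_Isub {i j : Fin p} {x : ℝ} (hi : x ∈ S.Isub i) (hj : x ∈ S.Isub j) : i = j := by
  by_contra h
  exact Set.disjoint_left.1 (S.hdisj i j h) hi hj

theorem branch_mem_dom (w : List (Fin p)) {x : ℝ} (hx : x ∈ S.dom) : S.branch w x ∈ S.dom := by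
  induction w with
  | nil => exact hx
  | cons i w ih => exact S.g_mem_dom i ih

theorem branchDer_ne_zero (w : List (Fin p)) {x : ℝ} (hx : x ∈ S.dom) : S.branchDer w x ≠ 0 := by
  induction w with
  | nil => exact one_ne_zero
  | cons i w ih => exact mul_ne_zero (S.hgder_ne i _ (S.branch_mem_dom w hx)) ih

theorem hasDerivWithinAt_branch (w : List (Fin p)) {x : ℝ} (hx : x ∈ S.dom) :
    HasDerivWithinAt (S.branch w) (S.branchDer w x) S.dom x := by
  induction w with
  | nil => exact hasDerivWithinAt_id x _
  | cons i w ih =>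
    exact (S.hg_deriv i _ (S.branch_mem_dom w hx)).comp x ih fun y hy => S.branch_mem_dom w hy

theorem continuousOn_branch (w : List (Fin p)) : ContinuousOn (S.branch w) S.dom :=
  fun _ hx => (S.hasDerivWithinAt_branch w hx).continuousWithinAt

theorem iterate_f_branch (w : List (Fin p)) {x : ℝ} (hx : x ∈ S.dom) :
    S.f^[w.length] (S.branch w x) = x := by
  induction w with
  | nil => rfl
  | cons i w ih =>
    rw [List.length_cons, Function.iterate_succ_apply]
    change S.f^[w.length] (S.f (S.g i (S.branch w x))) = x
    rw [S.f_g i (S.branch_mem_dom w hx), ih]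

theorem derIter_succ (n : ℕ) (x : ℝ) :
    S.derIter (n + 1) x = S.fder x * S.derIter n (S.f x) := by
  simp only [derIter, Finset.prod_range_succ', Function.iterate_succ_apply,
    Function.iterate_zero_apply]
  exact mul_comm _ _

theorem derIter_branch (w : List (Fin p)) {x : ℝ} (hx : x ∈ S.dom) :
    S.derIter w.length (S.branch w x) = (S.branchDer w x)⁻¹ := by
  induction w with
  | nil => simp [derIter, branchDer]
  | cons i w ih =>
    rw [List.length_cons, derIter_succ]
    change S.fder (S.g i (S.branch w x)) * S.derIter w.length (S.f (S.g i (S.branch w x))) = _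
    rw [S.f_g i (S.branch_mem_dom w hx), ih, S.hfder i _ (S.branch_mem_dom w hx)]
    exact (mul_inv _ _).symm

theorem injOn_branch (w : List (Fin p)) : InjOn (S.branch w) S.dom := by
  intro x hx y hy h
  rw [← S.iterate_f_branch w hx, h, S.iterate_f_branch w hy]

theorem cyl_append (w : List (Fin p)) {v : List (Fin p)} (hv : v ≠ []) :
    S.cyl (w ++ v) = S.branch w '' S.cyl v := by
  induction w with
  | nil => exact (image_id _).symm
  | cons i w ih =>
    rw [List.cons_append, S.cyl_cons i (by simp [hv]), ih, image_image]
    rfl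

theorem cyl_append_subset (w v : List (Fin p)) : S.cyl (w ++ v) ⊆ S.cyl w := by
  induction w with
  | nil => exact S.cyl_subset_I _
  | cons i w ih =>
    cases w with
    | nil => exact S.cyl_cons_subset_Isub i v
    | cons j w =>
      rw [List.cons_append, S.cyl_cons i (by simp), S.cyl_cons i (by simp)]
      exact image_mono ih

theorem eq_of_mem_cyl {v w : List (Fin p)} (h : v.length = w.length) {x : ℝ}
    (hv : x ∈ S.cyl v) (hw : x ∈ S.cyl w) : v = w := by
  induction v generalizing w x with
  | nil => exact (List.length_eq_zero_iff.1 h.symm).symm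
  | cons i v ih =>
    cases w with
    | nil => simp at h
    | cons j w =>
      obtain rfl := S.eq_of_mem_Isub (S.cyl_cons_subset_Isub i v hv)
        (S.cyl_cons_subset_Isub j w hw)
      rw [List.length_cons, List.length_cons, add_left_inj] at h
      by_cases hv0 : v = []
      · subst hv0
        rw [List.length_eq_zero_iff.1 h.symm]
      have hw0 : w ≠ [] := by
        rintro rfl
        exact hv0 (List.length_eq_zero_iff.1 h)
      rw [S.cyl_cons i hv0] at hv
      rw [S.cyl_cons i hw0] at hw
      obtain ⟨y, hy, rfl⟩ := hv
      obtain ⟨z, hz, hzy⟩ := hw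
      obtain rfl := S.hg_inj i (S.cyl_subset_dom hw0 hz) (S.cyl_subset_dom hv0 hy) hzy
      rw [ih h hy hz]

theorem isCompact_dom : IsCompact S.dom := by
  refine isCompact_iUnion fun i => ?_
  obtain ⟨a, b, -, h⟩ := S.hIsub i
  rw [h]
  exact isCompact_Icc

theorem isCompact_I : IsCompact S.I := by
  obtain ⟨a, b, -, h⟩ := S.hI
  rw [h]
  exact isCompact_Icc

theorem isCompact_Isub (i : Fin p) : IsCompact (S.Isub i) := by
  obtain ⟨a, b, -, h⟩ := S.hIsub i
  rw [h]
  exact isCompact_Icc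

theorem continuousOn_g (i : Fin p) : ContinuousOn (S.g i) S.dom :=
  fun x hx => (S.hg_deriv i x hx).continuousWithinAt

theorem isCompact_cyl (w : List (Fin p)) : IsCompact (S.cyl w) := by
  induction w with
  | nil => exact S.isCompact_I
  | cons i w ih =>
    by_cases hw : w = []
    · subst hw
      exact S.isCompact_Isub i
    · rw [S.cyl_cons i hw]
      exact ih.image_of_continuousOn ((S.continuousOn_g i).mono (S.cyl_subset_dom hw))

theorem dist_lt_of_mem_cyl {w : List (Fin p)} {ε x y : ℝ} (h : Metric.diam (S.cyl w) < ε)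
    (hx : x ∈ S.cyl w) (hy : y ∈ S.cyl w) : |x - y| < ε :=
  (Metric.dist_le_diam_of_mem (S.isCompact_cyl w).isBounded hx hy).trans_lt h

/-! ### Codes -/

theorem length_wordOf (ω : ℕ → Fin p) (n : ℕ) : (wordOf ω n).length = n := by
  simp [wordOf]

theorem wordOf_succ (ω : ℕ → Fin p) (n : ℕ) :
    wordOf ω (n + 1) = ω 0 :: wordOf (seqShift ω) n := by
  simp [wordOf, List.range_succ_eq_map, seqShift, Function.comp_def]

theorem wordOf_ne_nil (ω : ℕ → Fin p) {n : ℕ} (hn : n ≠ 0) : wordOf ω n ≠ [] := by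
  intro h
  exact hn (by simpa [h] using (length_wordOf ω n).symm)

theorem wordOf_add (ω : ℕ → Fin p) (n m : ℕ) :
    wordOf ω (n + m) = wordOf ω n ++ wordOf (fun k => ω (n + k)) m := by
  simp [wordOf, List.range_add, Function.comp_def]

theorem wordOf_congr {ω η : ℕ → Fin p} {n : ℕ} :
    wordOf ω n = wordOf η n ↔ ∀ k < n, ω k = η k := by
  simp [wordOf]

theorem seqShift_seqCons (i : Fin p) (ω : ℕ → Fin p) : seqShift (seqCons i ω) = ω := rfl

theorem seqCons_eq {ω η : ℕ → Fin p} (h : seqShift ω = η) : seqCons (ω 0) η = ω := by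
  subst h
  funext n
  cases n <;> rfl

variable {S}

theorem IsCode.mem_dom {ω : ℕ → Fin p} {x : ℝ} (h : S.IsCode ω x) : x ∈ S.dom :=
  S.cyl_subset_dom (wordOf_ne_nil ω one_ne_zero) (h 1)

theorem IsCode.mem_Isub {ω : ℕ → Fin p} {x : ℝ} (h : S.IsCode ω x) : x ∈ S.Isub (ω 0) := h 1

theorem IsCode.g_f {ω : ℕ → Fin p} {x : ℝ} (h : S.IsCode ω x) : S.g (ω 0) (S.f x) = x := by
  have h2 := h 2
  rw [wordOf_succ, S.cyl_cons _ (wordOf_ne_nil _ one_ne_zero)] at h2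
  obtain ⟨y, hy, rfl⟩ := h2
  rw [S.f_g _ (S.cyl_subset_dom (wordOf_ne_nil _ one_ne_zero) hy)]

theorem IsCode.shift {ω : ℕ → Fin p} {x : ℝ} (h : S.IsCode ω x) :
    S.IsCode (seqShift ω) (S.f x) := by
  have key : ∀ n, S.f x ∈ S.cyl (wordOf (seqShift ω) (n + 1)) := by
    intro n
    have h2 := h (n + 2)
    rw [wordOf_succ, S.cyl_cons _ (wordOf_ne_nil _ n.succ_ne_zero)] at h2
    obtain ⟨y, hy, rfl⟩ := h2
    rwa [S.f_g _ (S.cyl_subset_dom (wordOf_ne_nil _ n.succ_ne_zero) hy)]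
  intro n
  cases n with
  | zero => exact S.cyl_subset_I _ (key 0)
  | succ n => exact key n

theorem IsCode.iterate {ω : ℕ → Fin p} {x : ℝ} (h : S.IsCode ω x) (n : ℕ) :
    S.IsCode (fun k => ω (n + k)) (S.f^[n] x) := by
  induction n with
  | zero => simpa using h
  | succ n ih =>
    rw [Function.iterate_succ_apply']
    convert ih.shift using 1
    funext k
    simp only [seqShift]
    congr 1
    ring

theorem IsCode.cons {ω : ℕ → Fin p} {x : ℝ} (h : S.IsCode ω x) (i : Fin p) :
    S.IsCode (seqCons i ω) (S.g i x) := by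
  intro n
  match n with
  | 0 => exact S.hsubI i (S.g_mem_Isub i h.mem_dom)
  | 1 => exact S.g_mem_Isub i h.mem_dom
  | n + 2 =>
    rw [wordOf_succ, seqShift_seqCons, S.cyl_cons _ (wordOf_ne_nil _ n.succ_ne_zero)]
    exact ⟨x, h _, rfl⟩

theorem IsCode.branch_iterate {ω : ℕ → Fin p} {x : ℝ} (h : S.IsCode ω x) (n : ℕ) :
    S.branch (wordOf ω n) (S.f^[n] x) = x := by
  induction n generalizing ω x with
  | zero => rfl
  | succ n ih =>
    rw [wordOf_succ, Function.iterate_succ_apply]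
    change S.g (ω 0) _ = x
    rw [ih h.shift, h.g_f]

variable (S)

theorem mem_limitSet {x : ℝ} : x ∈ S.limitSet ↔ ∃ ω, avoids S.Q ω ∧ S.IsCode ω x := Iff.rfl

theorem avoids_shift {Q : Finset (List (Fin p))} {ω : ℕ → Fin p} (h : avoids Q ω) (n : ℕ) :
    avoids Q (fun k => ω (n + k)) := by
  intro w hw m hc
  refine h w hw (n + m) fun k hk => ?_
  rw [add_assoc]
  exact hc k hk

theorem limitSet_subset_dom : S.limitSet ⊆ S.dom := fun _ ⟨_, _, h⟩ => IsCode.mem_dom h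

theorem limitSet_subset_domF : S.limitSet ⊆ S.domF := by
  rintro x ⟨ω, -, h⟩
  have h' : S.IsCode ω x := h
  exact mem_iUnion.2 ⟨ω 0, S.f x, h'.shift.mem_dom, h'.g_f⟩

theorem mapsTo_f_limitSet : MapsTo S.f S.limitSet S.limitSet := by
  rintro x ⟨ω, hω, h⟩
  have h' : S.IsCode ω x := h
  refine ⟨seqShift ω, ?_, h'.shift⟩
  convert avoids_shift hω 1 using 1
  funext n
  simp [seqShift, add_comm]

/-- The maximal length of a forbidden word. -/
def forbLen : ℕ := S.Q.sup List.length

theorem avoids_glue {ω ζ : ℕ → Fin p} (n m : ℕ) (hm : S.forbLen ≤ m) (hω : avoids S.Q ω)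
    (hζ : avoids S.Q (fun k => ζ (n + k))) (h : ∀ k < n + m, ζ k = ω k) : avoids S.Q ζ := by
  intro w hw q hc
  have hlen : w.length ≤ m := (Finset.le_sup (f := List.length) hw).trans hm
  rcases le_or_gt n q with hq | hq
  · refine hζ w hw (q - n) fun k hk => ?_
    rw [← hc k hk]
    exact congrArg ζ (by omega)
  · refine hω w hw q fun k hk => ?_
    rw [← hc k hk, h (q + k) (by omega)]

/-- Cylinder neighbourhoods in the limit set are carried into the limit set by
inverse branches, as soon as the prefix is longer than the forbidden words. -/
theorem branch_mem_limitSet {ω : ℕ → Fin p} (hω : avoids S.Q ω) (n : ℕ) {m : ℕ}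
    (hm : S.forbLen ≤ m) {y : ℝ} (hy : y ∈ S.limitSet)
    (hyc : y ∈ S.cyl (wordOf (fun k => ω (n + k)) m)) :
    S.branch (wordOf ω n) y ∈ S.limitSet := by
  obtain ⟨η, hη, hcode⟩ := hy
  have hcode' : S.IsCode η y := hcode
  have hpre : wordOf η m = wordOf (fun k => ω (n + k)) m :=
    S.eq_of_mem_cyl (by simp [length_wordOf]) (hcode m) hyc
  rw [wordOf_congr] at hpre
  have key : ∀ (n : ℕ) (ω : ℕ → Fin p), ∃ ζ : ℕ → Fin p, S.IsCode ζ (S.branch (wordOf ω n) y) ∧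
      (∀ k < n, ζ k = ω k) ∧ ∀ k, ζ (n + k) = η k := by
    intro n
    induction n with
    | zero =>
      intro ω
      exact ⟨η, hcode', by simp, by simp⟩
    | succ n ih =>
      intro ω
      obtain ⟨ζ, h1, h2, h3⟩ := ih (seqShift ω)
      refine ⟨seqCons (ω 0) ζ, ?_, ?_, ?_⟩
      · rw [wordOf_succ]
        exact h1.cons _
      · intro k hk
        cases k with
        | zero => rfl
        | succ k => exact h2 k (by omega)
      · intro k
        rw [show n + 1 + k = (n + k) + 1 by ring]
        exact h3 k
  obtain ⟨ζ, h1, h2, h3⟩ := key n ω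
  refine ⟨ζ, S.avoids_glue n m hm hω ?_ ?_, h1⟩
  · simpa only [h3] using hη
  · intro k hk
    rcases lt_or_ge k n with hkn | hkn
    · exact h2 k hkn
    · obtain ⟨j, rfl⟩ := Nat.exists_eq_add_of_le hkn
      rw [h3, hpre j (by omega)]

/-! ### Topology of the limit set -/

theorem isClosed_avoids (Q : Finset (List (Fin p))) : IsClosed {ω : ℕ → Fin p | avoids Q ω} := by
  have : {ω : ℕ → Fin p | avoids Q ω} = ⋂ w ∈ Q, ⋂ n : ℕ, {ω | containsAt ω w n}ᶜ := by
    ext ω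
    simp [avoids]
  rw [this]
  refine isClosed_biInter fun w _ => isClosed_iInter fun n => IsOpen.isClosed_compl ?_
  have : {ω : ℕ → Fin p | containsAt ω w n} =
      ⋂ k : Fin w.length, (fun ω : ℕ → Fin p => ω (n + k)) ⁻¹' {w.get k} := by
    ext ω
    simp [containsAt, Fin.forall_iff]
  rw [this]
  exact isOpen_iInter_of_finite fun k =>
    (isOpen_discrete _).preimage (continuous_apply (n + (k : ℕ)))

theorem isClosed_wordOf_eq (v : List (Fin p)) (n : ℕ) :
    IsClosed {ω : ℕ → Fin p | wordOf ω n = v} := by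
  by_cases hv : ∃ η : ℕ → Fin p, wordOf η n = v
  · obtain ⟨η, rfl⟩ := hv
    have : {ω : ℕ → Fin p | wordOf ω n = wordOf η n} =
        ⋂ k : Fin n, (fun ω : ℕ → Fin p => ω k) ⁻¹' {η k} := by
      ext ω
      simp [wordOf_congr, Fin.forall_iff]
    rw [this]
    exact isClosed_iInter fun k => (isClosed_discrete _).preimage (continuous_apply (k : ℕ))
  · push Not at hv
    have : {ω : ℕ → Fin p | wordOf ω n = v} = ∅ := by
      ext ω
      simp [hv ω]
    rw [this]
    exact isClosed_empty

theorem isClosed_limitSet : IsClosed S.limitSet := by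
  have hK : IsClosed {z : (ℕ → Fin p) × ℝ | avoids S.Q z.1 ∧ S.IsCode z.1 z.2} := by
    refine ((isClosed_avoids S.Q).preimage continuous_fst).inter ?_
    have : {z : (ℕ → Fin p) × ℝ | S.IsCode z.1 z.2} = ⋂ n : ℕ,
        ⋃ v ∈ {v : List (Fin p) | v.length = n}, {ω : ℕ → Fin p | wordOf ω n = v} ×ˢ S.cyl v := by
      ext z
      simp only [IsCode, mem_ofPred_eq, mem_iInter, mem_iUnion, mem_prod, exists_prop]
      refine forall_congr' fun n => ⟨fun h => ⟨_, length_wordOf _ _, rfl, h⟩, ?_⟩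
      rintro ⟨v, -, rfl, h⟩
      exact h
    change IsClosed {z : (ℕ → Fin p) × ℝ | S.IsCode z.1 z.2}
    rw [this]
    exact isClosed_iInter fun n => (List.finite_length_eq (Fin p) n).isClosed_biUnion fun v _ =>
      (isClosed_wordOf_eq v n).prod (S.isCompact_cyl v).isClosed
  have : S.limitSet = Prod.snd '' {z : (ℕ → Fin p) × ℝ | avoids S.Q z.1 ∧ S.IsCode z.1 z.2} := by
    ext x
    simp [mem_limitSet]
  rw [this]
  exact isClosedMap_snd_of_compactSpace _ hK

theorem isCompact_limitSet : IsCompact S.limitSet :=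
  S.isCompact_dom.of_isClosed_subset S.isClosed_limitSet S.limitSet_subset_dom

/-- Cylinders are relatively open in the limit set. -/
theorem exists_isOpen_inter_limitSet (v : List (Fin p)) :
    ∃ U : Set ℝ, IsOpen U ∧ U ∩ S.limitSet = S.cyl v ∩ S.limitSet := by
  refine ⟨(⋃ u ∈ {u : List (Fin p) | u.length = v.length} \ {v}, S.cyl u)ᶜ,
    (((List.finite_length_eq (Fin p) _).sdiff).isClosed_biUnion fun u _ =>
      (S.isCompact_cyl u).isClosed).isOpen_compl, ?_⟩
  ext x
  simp only [mem_inter_iff, mem_compl_iff, mem_iUnion, Set.mem_sdiff, mem_ofPred_eq, mem_singleton_iff,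
    exists_prop, not_exists, not_and, and_imp, and_congr_left_iff]
  rintro ⟨ω, -, h⟩
  constructor
  · intro hx
    by_contra hv
    refine hx (wordOf ω v.length) (length_wordOf _ _) ?_ (h _)
    rintro h'
    exact hv (h' ▸ h v.length)
  · intro hx u hu huv hxu
    exact huv (S.eq_of_mem_cyl hu hxu hx)

end ExpansiveMarkovSystem

namespace ExpansiveMarkovSystem

variable {p : ℕ} (S : ExpansiveMarkovSystem p)

/-! ### Continuity of the expanding map and of its derivative -/

theorem continuousOn_domF_of_comp_g {h : ℝ → ℝ}
    (hh : ∀ i, ContinuousOn (fun x => h (S.g i x)) S.dom) : ContinuousOn h S.domF := by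
  refine continuousOn_iff_isClosed.2 fun t ht => ?_
  refine ⟨⋃ i, S.g i '' (S.dom ∩ (fun x => h (S.g i x)) ⁻¹' t), ?_, ?_⟩
  · refine isClosed_iUnion_of_finite fun i => IsCompact.isClosed ?_
    refine IsCompact.image_of_continuousOn ?_ ((S.continuousOn_g i).mono inter_subset_left)
    exact S.isCompact_dom.of_isClosed_subset
      ((hh i).preimage_isClosed_of_isClosed S.isCompact_dom.isClosed ht) inter_subset_left
  · ext x
    simp only [domF, mem_inter_iff, mem_preimage, mem_iUnion, mem_image]
    constructor
    · rintro ⟨hx, i, y, hy, rfl⟩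
      exact ⟨⟨i, y, ⟨hy, hx⟩, rfl⟩, i, y, hy, rfl⟩
    · rintro ⟨⟨i, y, ⟨hy, hx⟩, rfl⟩, h⟩
      exact ⟨hx, h⟩

theorem continuousOn_f : ContinuousOn S.f S.domF :=
  S.continuousOn_domF_of_comp_g fun i => continuousOn_id.congr fun _ hx => S.f_g i hx

theorem continuousOn_fder : ContinuousOn S.fder S.domF :=
  S.continuousOn_domF_of_comp_g fun i =>
    ((S.hgder_cont i).inv₀ (S.hgder_ne i)).congr fun x hx => S.hfder i x hx

theorem fder_ne_zero {x : ℝ} (hx : x ∈ S.domF) : S.fder x ≠ 0 := by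
  obtain ⟨i, y, hy, rfl⟩ := mem_iUnion.1 hx
  rw [S.hfder i y hy]
  exact inv_ne_zero (S.hgder_ne i y hy)

theorem mapsTo_iterate_limitSet (n : ℕ) : MapsTo S.f^[n] S.limitSet S.limitSet :=
  S.mapsTo_f_limitSet.iterate n

theorem continuousOn_f_limitSet : ContinuousOn S.f S.limitSet :=
  S.continuousOn_f.mono S.limitSet_subset_domF

theorem continuousOn_fder_limitSet : ContinuousOn S.fder S.limitSet :=
  S.continuousOn_fder.mono S.limitSet_subset_domF

theorem continuousOn_derIter (n : ℕ) : ContinuousOn (S.derIter n) S.limitSet := by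
  refine continuousOn_finsetProd _ fun k _ => ?_
  exact S.continuousOn_fder_limitSet.comp (S.continuousOn_f_limitSet.iterate
    S.mapsTo_f_limitSet k) (S.mapsTo_iterate_limitSet k)

theorem derIter_ne_zero {x : ℝ} (hx : x ∈ S.limitSet) (n : ℕ) : S.derIter n x ≠ 0 :=
  Finset.prod_ne_zero_iff.2 fun k _ =>
    S.fder_ne_zero (S.limitSet_subset_domF (S.mapsTo_iterate_limitSet k hx))

/-! ### Iterating conformality -/

variable {S} {ν : Measure ℝ} {t : ℝ}

/-- The change of variables formula associated with a conformal measure. -/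
theorem IsConformal.lintegral_image (hν : S.IsConformal ν t) {E : Set ℝ} (hE : MeasurableSet E)
    (hEΛ : E ⊆ S.limitSet) (hinj : InjOn S.f E) {h : ℝ → ENNReal}
    (hh : AEMeasurable h (ν.restrict (S.f '' E))) :
    ∫⁻ y in S.f '' E, h y ∂ν =
      ∫⁻ x in E, ENNReal.ofReal (|S.fder x| ^ t) * h (S.f x) ∂ν := by
  have hfE : ContinuousOn S.f E := S.continuousOn_f_limitSet.mono hEΛ
  have hf : AEMeasurable S.f (ν.restrict E) := hfE.aemeasurable hE
  have hρ : AEMeasurable (fun x => ENNReal.ofReal (|S.fder x| ^ t)) (ν.restrict E) := by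
    refine ENNReal.measurable_ofReal.comp_aemeasurable ?_
    refine ContinuousOn.aemeasurable ?_ hE
    exact (S.continuousOn_fder_limitSet.mono hEΛ).abs.rpow_const fun x hx =>
      Or.inl (abs_ne_zero.2 (S.fder_ne_zero (S.limitSet_subset_domF (hEΛ hx))))
  set m := (ν.restrict E).withDensity fun x => ENNReal.ofReal (|S.fder x| ^ t) with hm
  have hfm : AEMeasurable S.f m := hf.mono_ac (withDensity_absolutelyContinuous _ _)
  have hmap : m.map S.f = ν.restrict (S.f '' E) := by
    ext A hA
    rw [Measure.map_apply_of_aemeasurable hfm hA, Measure.restrict_apply hA,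
      show A ∩ S.f '' E = S.f '' (E ∩ S.f ⁻¹' A) by rw [image_inter_preimage, inter_comm]]
    have hmeas : MeasurableSet (E ∩ S.f ⁻¹' A) := by
      have : E ∩ S.f ⁻¹' A = E ∩ E.piecewise S.f 0 ⁻¹' A := by
        ext x
        simp +contextual
      rw [this]
      exact hE.inter (hfE.measurable_piecewise continuousOn_const hE hA)
    have := hν.1
    rw [hν.2.2 _ hmeas (inter_subset_left.trans hEΛ) (hinj.mono inter_subset_left), hm,
      withDensity_apply', Measure.restrict_restrict' hE, inter_comm]
  rw [← hmap] at hh ⊢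
  rw [lintegral_map' hh hfm]
  exact lintegral_withDensity_eq_lintegral_mul₀' hρ (hh.comp_aemeasurable hfm)

theorem aemeasurable_derIter_rpow (n : ℕ) {E : Set ℝ} (hE : MeasurableSet E)
    (hEΛ : E ⊆ S.limitSet) :
    AEMeasurable (fun x => ENNReal.ofReal (|S.derIter n x| ^ t)) (ν.restrict E) := by
  refine ENNReal.measurable_ofReal.comp_aemeasurable (ContinuousOn.aemeasurable ?_ hE)
  exact ((S.continuousOn_derIter n).mono hEΛ).abs.rpow_const fun x hx =>
    Or.inl (abs_ne_zero.2 (S.derIter_ne_zero (hEΛ hx) n))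

theorem IsConformal.measure_iterate_image (hν : S.IsConformal ν t) (n : ℕ) {E : Set ℝ}
    (hE : MeasurableSet E) (hEΛ : E ⊆ S.limitSet) (hinj : InjOn S.f^[n] E) :
    ν (S.f^[n] '' E) = ∫⁻ x in E, ENNReal.ofReal (|S.derIter n x| ^ t) ∂ν := by
  induction n generalizing E with
  | zero => simp [derIter]
  | succ n ih =>
    have h1 : InjOn S.f E := fun x hx y hy h => hinj hx hy (by
      rw [Function.iterate_succ_apply, Function.iterate_succ_apply, h])
    have h2 : InjOn S.f^[n] (S.f '' E) := by
      rintro _ ⟨x, hx, rfl⟩ _ ⟨y, hy, rfl⟩ h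
      rw [hinj hx hy h]
    have hm : MeasurableSet (S.f '' E) :=
      hE.image_of_continuousOn_injOn (S.continuousOn_f_limitSet.mono hEΛ) h1
    have hΛ : S.f '' E ⊆ S.limitSet := (image_mono hEΛ).trans S.mapsTo_f_limitSet.image_subset
    rw [Function.iterate_succ, image_comp, ih hm hΛ h2,
      hν.lintegral_image hE hEΛ h1 (aemeasurable_derIter_rpow n hm hΛ)]
    refine setLIntegral_congr_fun hE fun x _ => ?_
    rw [derIter_succ, abs_mul, Real.mul_rpow (abs_nonneg _) (abs_nonneg _),
      ENNReal.ofReal_mul (by positivity)]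

variable (S) in
theorem measurableSet_cyl_inter (v : List (Fin p)) : MeasurableSet (S.cyl v ∩ S.limitSet) :=
  (S.isCompact_cyl v).isClosed.measurableSet.inter S.isClosed_limitSet.measurableSet

theorem IsConformal.measure_cyl (hν : S.IsConformal ν t) {ω : ℕ → Fin p} (hω : avoids S.Q ω)
    (n : ℕ) {m : ℕ} (hm : S.forbLen ≤ m) :
    ν (S.cyl (wordOf (fun k => ω (n + k)) m) ∩ S.limitSet) =
      ∫⁻ x in S.branch (wordOf ω n) '' (S.cyl (wordOf (fun k => ω (n + k)) m) ∩ S.limitSet),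
        ENNReal.ofReal (|S.derIter n x| ^ t) ∂ν := by
  set K := S.cyl (wordOf (fun k => ω (n + k)) m) ∩ S.limitSet
  have hKdom : K ⊆ S.dom := inter_subset_right.trans S.limitSet_subset_dom
  have hit : ∀ y ∈ K, S.f^[n] (S.branch (wordOf ω n) y) = y := by
    intro y hy
    simpa [length_wordOf] using S.iterate_f_branch (wordOf ω n) (hKdom hy)
  have hinj : InjOn S.f^[n] (S.branch (wordOf ω n) '' K) := by
    rintro _ ⟨x, hx, rfl⟩ _ ⟨y, hy, rfl⟩ h
    rw [hit x hx, hit y hy] at h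
    rw [h]
  have hmeas : MeasurableSet (S.branch (wordOf ω n) '' K) :=
    (S.measurableSet_cyl_inter _).image_of_continuousOn_injOn
      ((S.continuousOn_branch _).mono hKdom) ((S.injOn_branch _).mono hKdom)
  rw [← hν.measure_iterate_image n hmeas ?_ hinj]
  · congr 1
    rw [image_image]
    ext x
    constructor
    · intro hx
      exact ⟨x, hx, hit x hx⟩
    · rintro ⟨y, hy, rfl⟩
      change S.f^[n] (S.branch (wordOf ω n) y) ∈ K
      rwa [hit y hy]
  · rintro _ ⟨y, hy, rfl⟩
    exact S.branch_mem_limitSet hω n hm hy.2 hy.1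

/-- Conformal measures have full support. -/
theorem IsConformal.measure_cyl_pos (hν : S.IsConformal ν t) {v : List (Fin p)}
    (hv : (S.cyl v ∩ S.limitSet).Nonempty) : 0 < ν (S.cyl v ∩ S.limitSet) := by
  have := hν.1
  rw [pos_iff_ne_zero]
  intro h0
  set M := max S.forbLen v.length
  have hcover : S.limitSet ⊆ ⋃ u ∈ {u : List (Fin p) | u.length = M}, S.cyl u ∩ S.limitSet := by
    rintro x ⟨ω, hω, h⟩
    simp only [mem_iUnion]
    exact ⟨wordOf ω M, length_wordOf _ _, h M, ω, hω, h⟩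
  have hzero : ν S.limitSet = 0 := by
    refine measure_mono_null hcover ?_
    refine (measure_biUnion_null_iff (List.finite_length_eq (Fin p) M).countable).2 fun u hu => ?_
    rcases (S.cyl u ∩ S.limitSet).eq_empty_or_nonempty with hu0 | hu0
    · rw [hu0, measure_empty]
    obtain ⟨U, hU, hUv⟩ := S.exists_isOpen_inter_limitSet v
    obtain ⟨V, hV, hVu⟩ := S.exists_isOpen_inter_limitSet u
    obtain ⟨n, x, hx, hxV⟩ := S.htrans U V hU hV (by rwa [← limitSet, hUv])
      (by rwa [← limitSet, hVu])
    have hxv : x ∈ S.cyl v ∩ S.limitSet := hUv ▸ hx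
    have hxu : S.f^[n] x ∈ S.cyl u :=
      (hVu.subset ⟨hxV, S.mapsTo_iterate_limitSet n hxv.2⟩).1
    obtain ⟨ω, hω, hc⟩ := hxv.2
    have hc' : S.IsCode ω x := hc
    have hwu : wordOf (fun k => ω (n + k)) M = u :=
      S.eq_of_mem_cyl ((length_wordOf _ _).trans (Eq.symm hu)) (hc'.iterate n M) hxu
    have hwv : wordOf ω v.length = v := S.eq_of_mem_cyl (length_wordOf _ _) (hc' _) hxv.1
    have hform := hν.measure_cyl hω n (m := M) (le_max_left _ _)
    rw [hwu] at hform
    rw [hform, setLIntegral_measure_zero]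
    refine measure_mono_null ?_ h0
    rintro _ ⟨y, hy, rfl⟩
    refine ⟨?_, S.branch_mem_limitSet hω n (le_max_left _ _) hy.2 (hwu ▸ hy.1)⟩
    by_cases hu' : u = []
    · have hM : M = 0 := by simpa [hu'] using Eq.symm hu
      have : v = [] := List.length_eq_zero_iff.1 (by omega)
      subst this
      exact S.dom_subset_I (S.branch_mem_dom _ (S.limitSet_subset_dom hy.2))
    have h3 : S.branch (wordOf ω n) y ∈ S.cyl (wordOf ω (n + M)) := by
      rw [wordOf_add, hwu, S.cyl_append _ hu']
      exact ⟨y, hy.1, rfl⟩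
    obtain ⟨j, hj⟩ : ∃ j, n + M = v.length + j :=
      Nat.exists_eq_add_of_le ((le_max_right _ _).trans (Nat.le_add_left _ _))
    rw [hj, wordOf_add, hwv] at h3
    exact S.cyl_append_subset _ _ h3
  have huniv : ν univ = 0 := by
    rw [← union_compl_self S.limitSet]
    exact measure_union_null hzero hν.2.1
  simp at huniv

end ExpansiveMarkovSystem

/-! ### A mass distribution principle -/

theorem dimH_le_of_frequently_closedBall_mass {X : Type*} [MetricSpace X]
    [SecondCountableTopology X] [MeasurableSpace X] [BorelSpace X] (ν : Measure X)
    [IsFiniteMeasure ν] {t : ℝ} (ht : 0 ≤ t) {E : Set X}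
    (hE : ∀ x ∈ E, ∃ c : ℝ, 0 < c ∧ ∀ ε : ℝ, 0 < ε → ∃ r : ℝ, 0 < r ∧ r < ε ∧
      ENNReal.ofReal (c * r ^ t) ≤ ν (closedBall x r)) :
    dimH E ≤ ENNReal.ofReal t := by
  set F : ℕ → Set X := fun m => {x | ∀ ε : ℝ, 0 < ε → ∃ r : ℝ, 0 < r ∧ r < ε ∧
      ENNReal.ofReal (r ^ t) ≤ m * ν (closedBall x r)} with hF
  have hEF : E ⊆ ⋃ m, F m := by
    intro x hx
    obtain ⟨c, hc, h⟩ := hE x hx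
    obtain ⟨m, hm⟩ := exists_nat_ge c⁻¹
    refine mem_iUnion.2 ⟨m, fun ε hε => ?_⟩
    obtain ⟨r, hr, hrε, h⟩ := h ε hε
    refine ⟨r, hr, hrε, ?_⟩
    calc ENNReal.ofReal (r ^ t) ≤ ENNReal.ofReal (m * (c * r ^ t)) := by
          refine ENNReal.ofReal_le_ofReal ?_
          have h1 : 1 ≤ m * c := by
            rw [inv_le_iff_one_le_mul₀ hc] at hm
            exact hm
          have h2 : 0 ≤ r ^ t := Real.rpow_nonneg hr.le t
          nlinarith
      _ = m * ENNReal.ofReal (c * r ^ t) := by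
          rw [ENNReal.ofReal_mul (by positivity), ENNReal.ofReal_natCast]
      _ ≤ m * ν (closedBall x r) := by gcongr
  refine (dimH_mono hEF).trans ?_
  rw [dimH_iUnion]
  refine iSup_le fun m => ?_
  change dimH (F m) ≤ ((t.toNNReal : NNReal) : ENNReal)
  refine dimH_le_of_hausdorffMeasure_ne_top ?_
  rw [Real.coe_toNNReal t ht]
  have hpos : ∀ k : ℕ, (0 : ℝ) < 1 / ((k : ℝ) + 1) := fun k => by positivity
  have hch : ∀ (k : ℕ) (x : X), ∃ r : ℝ, x ∈ F m → 0 < r ∧ r < 1 / ((k : ℝ) + 1) ∧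
      ENNReal.ofReal (r ^ t) ≤ m * ν (closedBall x r) := by
    intro k x
    by_cases hx : x ∈ F m
    · obtain ⟨r, h⟩ := hx _ (hpos k)
      exact ⟨r, fun _ => h⟩
    · exact ⟨0, fun h => absurd h hx⟩
  choose r hr using hch
  have hvit : ∀ k : ℕ, ∃ u ⊆ F m, (u.PairwiseDisjoint fun a => closedBall a (r k a)) ∧
      ∀ a ∈ F m, ∃ b ∈ u, closedBall a (r k a) ⊆ closedBall b (5 * r k b) := fun k =>
    Vitali.exists_disjoint_subfamily_covering_enlargement_closedBall (F m) id (r k)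
      (1 / ((k : ℝ) + 1)) (fun a ha => (hr k a ha).2.1.le) 5 (by norm_num)
  choose u huF hud hcov using hvit
  have hcount : ∀ k, (u k).Countable := fun k =>
    (hud k).countable_of_nonempty_interior fun a ha =>
      ⟨a, ball_subset_interior_closedBall (mem_ball_self (hr k a (huF k ha)).1)⟩
  have : ∀ k, Countable (u k) := fun k => (hcount k).to_subtype
  have hdiam : ∀ (k : ℕ) (b : u k), ediam (closedBall (b : X) (5 * r k b)) ≤
      ENNReal.ofReal (10 * r k b) := by
    intro k b
    refine ediam_le fun a ha c hc => ?_
    rw [edist_dist]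
    refine ENNReal.ofReal_le_ofReal ((dist_triangle_right a c b).trans ?_)
    linarith [mem_closedBall.1 ha, mem_closedBall.1 hc]
  have hsum : ∀ k, ∑' b : u k, ediam (closedBall (b : X) (5 * r k b)) ^ t ≤
      ENNReal.ofReal (10 ^ t) * (m * ν univ) := by
    intro k
    calc ∑' b : u k, ediam (closedBall (b : X) (5 * r k b)) ^ t
        ≤ ∑' b : u k, ENNReal.ofReal (10 ^ t) * (m * ν (closedBall (b : X) (r k b))) := by
          refine ENNReal.tsum_le_tsum fun b => ?_
          have h0 := hr k b (huF k b.2)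
          calc ediam (closedBall (b : X) (5 * r k b)) ^ t
              ≤ ENNReal.ofReal (10 * r k b) ^ t := ENNReal.rpow_le_rpow (hdiam k b) ht
            _ = ENNReal.ofReal (10 ^ t) * ENNReal.ofReal (r k b ^ t) := by
              rw [ENNReal.ofReal_rpow_of_nonneg (by linarith [h0.1]) ht,
                Real.mul_rpow (by norm_num) h0.1.le, ENNReal.ofReal_mul (by positivity)]
            _ ≤ _ := by gcongr; exact h0.2.2
      _ = ENNReal.ofReal (10 ^ t) * (m * ∑' b : u k, ν (closedBall (b : X) (r k b))) := by
          rw [ENNReal.tsum_mul_left, ENNReal.tsum_mul_left]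
      _ ≤ _ := by
          gcongr
          rw [← measure_biUnion (hcount k) (hud k) fun b _ => isClosed_closedBall.measurableSet]
          exact measure_mono (subset_univ _)
  have hlim : Tendsto (fun k : ℕ => ENNReal.ofReal (10 * (1 / ((k : ℝ) + 1)))) atTop (nhds 0) := by
    have := (tendsto_one_div_add_atTop_nhds_zero_nat (𝕜 := ℝ)).const_mul 10
    rw [mul_zero] at this
    simpa using ENNReal.tendsto_ofReal this
  have hle := Measure.hausdorffMeasure_le_liminf_tsum t (F m) (l := atTop) _ hlim
    (fun k (b : u k) => closedBall (b : X) (5 * r k b))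
    (Eventually.of_forall fun k b => (hdiam k b).trans (ENNReal.ofReal_le_ofReal (by
      have := (hr k b (huF k b.2)).2.1
      linarith)))
    (Eventually.of_forall fun k x hx => by
      obtain ⟨b, hb, hxb⟩ := hcov k x hx
      exact mem_iUnion.2 ⟨⟨b, hb⟩, hxb (mem_closedBall_self (hr k x hx).1.le)⟩)
  refine ne_top_of_le_ne_top ?_ (hle.trans ((liminf_le_liminf
    (Eventually.of_forall hsum)).trans_eq (liminf_const _)))
  finiteness

/-! ### Bounded distortion on one branch -/

section Distortion

variable {a b : ℝ} {G G' : ℝ → ℝ} {x r : ℝ}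

theorem exists_deriv_eq_of_preimage_ball (hG : ∀ Y ∈ Icc a b, HasDerivWithinAt G (G' Y) (Icc a b) Y)
    (hinj : InjOn G (Icc a b)) {Y Z : ℝ} (hY : Y ∈ Icc a b ∩ G ⁻¹' ball x r)
    (hZ : Z ∈ Icc a b ∩ G ⁻¹' ball x r) :
    ∃ ξ ∈ Icc a b ∩ G ⁻¹' ball x r, |G Y - G Z| = |G' ξ| * |Y - Z| := by
  wlog hYZ : Y < Z generalizing Y Z
  · rcases (not_lt.1 hYZ).eq_or_lt with h | h
    · exact ⟨Y, hY, by simp [h]⟩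
    · obtain ⟨ξ, hξ, h⟩ := this hZ hY h
      exact ⟨ξ, hξ, by rw [abs_sub_comm, h, abs_sub_comm]⟩
  have hcont : ContinuousOn G (Icc a b) := fun Y hY => (hG Y hY).continuousWithinAt
  have hsub : Icc Y Z ⊆ Icc a b := Icc_subset_Icc hY.1.1 hZ.1.2
  obtain ⟨ξ, hξ, h⟩ := exists_hasDerivAt_eq_slope G G' hYZ (hcont.mono hsub) fun ξ hξ =>
    (hG ξ (hsub (Ioo_subset_Icc_self hξ))).hasDerivAt
      (Icc_mem_nhds (hY.1.1.trans_lt hξ.1) (hξ.2.trans_le hZ.1.2))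
  refine ⟨ξ, ⟨hsub (Ioo_subset_Icc_self hξ), ?_⟩, ?_⟩
  · have hoc : OrdConnected (ball x r) := (convex_ball x r).ordConnected
    refine hoc.uIcc_subset hY.2 hZ.2 ?_
    have hξ' := hsub (Ioo_subset_Icc_self hξ)
    rcases hcont.strictMonoOn_of_injOn_Icc' (hY.1.1.trans hY.1.2) hinj with hm | hm
    · exact mem_uIcc_of_le (hm.monotoneOn hY.1 hξ' hξ.1.le) (hm.monotoneOn hξ' hZ.1 hξ.2.le)
    · exact mem_uIcc_of_ge (hm.antitoneOn hξ' hZ.1 hξ.2.le) (hm.antitoneOn hY.1 hξ' hξ.1.le)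
  · rw [h, abs_sub_comm (G Y), abs_sub_comm Y, abs_div, div_mul_cancel₀]
    exact abs_ne_zero.2 (sub_ne_zero.2 hYZ.ne')

variable {c₁ c₂ : ℝ}

theorem mem_ball_of_close (hG : ∀ Y ∈ Icc a b, HasDerivWithinAt G (G' Y) (Icc a b) Y)
    (hG0 : ∀ Y ∈ Icc a b, G' Y ≠ 0) (hinj : InjOn G (Icc a b)) (hr : 0 < r)
    (hc₁ : 0 < c₁) (hc₂ : 0 < c₂)
    (hdiam : c₁ < Metric.diam (Icc a b ∩ G ⁻¹' ball x r))
    (hdist : ∀ Y ∈ Icc a b ∩ G ⁻¹' ball x r, ∀ Z ∈ Icc a b ∩ G ⁻¹' ball x r,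
      |G' Y| ≤ c₂ * |G' Z|) {X Y : ℝ} (hX : X ∈ Icc a b) (hXx : G X = x) (hY : Y ∈ Icc a b)
    (hXY : |Y - X| < c₁ / (4 * c₂ ^ 2)) : G Y ∈ ball x r := by
  have hXJ : X ∈ Icc a b ∩ G ⁻¹' ball x r := ⟨hX, by simpa [hXx] using hr⟩
  have hD : 0 < |G' X| := abs_pos.2 (hG0 X hX)
  have hDr : |G' X| * c₁ ≤ 2 * r * c₂ := by
    obtain ⟨P, hP, Q, hQ, hPQ⟩ : ∃ P ∈ Icc a b ∩ G ⁻¹' ball x r,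
        ∃ Q ∈ Icc a b ∩ G ⁻¹' ball x r, c₁ < dist P Q := by
      by_contra! h
      exact absurd (Metric.diam_le_of_forall_dist_le hc₁.le h) (not_le.2 hdiam)
    obtain ⟨ξ, hξ, h⟩ := exists_deriv_eq_of_preimage_ball hG hinj hP hQ
    have h1 : |G P - G Q| ≤ 2 * r := by
      have hP2 := hP.2
      have hQ2 := hQ.2
      rw [mem_preimage, mem_ball] at hP2 hQ2
      have := dist_triangle_right (G P) (G Q) x
      rw [Real.dist_eq] at this
      linarith
    have h2 := hdist X hXJ ξ hξ
    rw [Real.dist_eq] at hPQ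
    have h3 : |G' ξ| * c₁ ≤ 2 * r := by
      refine le_trans ?_ h1
      rw [h]
      gcongr
    nlinarith
  by_contra hYb
  have hcont : ContinuousOn (fun W => |G W - x|) (uIcc X Y) := by
    have h : ContinuousOn G (Icc a b) := fun Y hY => (hG Y hY).continuousWithinAt
    exact ((h.mono (ordConnected_Icc.uIcc_subset hX hY)).sub continuousOn_const).abs
  rw [mem_ball, Real.dist_eq, not_lt] at hYb
  obtain ⟨W, hW, hWr⟩ := intermediate_value_uIcc hcont
    (show r / 2 ∈ uIcc |G X - x| |G Y - x| from
      mem_uIcc_of_le (by simp [hXx]; linarith) (by linarith))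
  change |G W - x| = r / 2 at hWr
  have hWJ : W ∈ Icc a b ∩ G ⁻¹' ball x r := by
    refine ⟨ordConnected_Icc.uIcc_subset hX hY hW, ?_⟩
    rw [mem_preimage, mem_ball, Real.dist_eq, hWr]
    linarith
  obtain ⟨ξ, hξ, h⟩ := exists_deriv_eq_of_preimage_ball hG hinj hWJ hXJ
  rw [hXx, hWr] at h
  have h1 := hdist ξ hξ X hXJ
  have h2 : |W - X| ≤ |Y - X| := abs_sub_left_of_mem_uIcc hW
  have h3 : |W - X| * (4 * c₂ ^ 2) < c₁ := by
    rw [lt_div_iff₀ (by positivity)] at hXY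
    exact lt_of_le_of_lt (by gcongr) hXY
  have h4 : r / 2 ≤ c₂ * |G' X| * |W - X| := by
    rw [h]
    gcongr
  have h5 : |G' X| * (|W - X| * (4 * c₂ ^ 2)) < |G' X| * c₁ := by gcongr
  nlinarith

theorem radius_le_deriv (hG : ∀ Y ∈ Icc a b, HasDerivWithinAt G (G' Y) (Icc a b) Y)
    (hinj : InjOn G (Icc a b)) (hr : 0 < r) (hc₂ : 0 < c₂)
    (hsub : ball x r ⊆ G '' Icc a b)
    (hdist : ∀ Y ∈ Icc a b ∩ G ⁻¹' ball x r, ∀ Z ∈ Icc a b ∩ G ⁻¹' ball x r,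
      |G' Y| ≤ c₂ * |G' Z|) {Y : ℝ} (hY : Y ∈ Icc a b ∩ G ⁻¹' ball x r) :
    r ≤ c₂ * (b - a) * |G' Y| := by
  have hp : x + r / 2 ∈ ball x r := by
    rw [mem_ball, Real.dist_eq, add_sub_cancel_left, abs_of_pos] <;> linarith
  have hm : x - r / 2 ∈ ball x r := by
    rw [mem_ball, Real.dist_eq, sub_sub_cancel_left, abs_neg, abs_of_pos] <;> linarith
  obtain ⟨P, hP, hPe⟩ := hsub hp
  obtain ⟨Q, hQ, hQe⟩ := hsub hm
  obtain ⟨ξ, hξ, h⟩ := exists_deriv_eq_of_preimage_ball hG hinj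
    (Y := P) (Z := Q) (x := x) (r := r) ⟨hP, by rwa [mem_preimage, hPe]⟩
    ⟨hQ, by rwa [mem_preimage, hQe]⟩
  have h1 : |P - Q| ≤ b - a := abs_sub_le_iff.2 ⟨by linarith [hP.2, hQ.1], by linarith [hP.1, hQ.2]⟩
  have h2 : |G P - G Q| = r := by
    rw [hPe, hQe, show x + r / 2 - (x - r / 2) = r by ring, abs_of_pos hr]
  rw [h2] at h
  calc r = |G' ξ| * |P - Q| := h
    _ ≤ (c₂ * |G' Y|) * (b - a) := by
      gcongr
      exact hdist ξ hξ Y hY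
    _ = _ := by ring

end Distortion

namespace ExpansiveMarkovSystem

variable {p : ℕ} (S : ExpansiveMarkovSystem p)

/-! ### The dimension bound from a conformal measure -/

theorem exists_mem_cyl_of_iterate_mem_domF (n : ℕ) {y : ℝ}
    (hy : ∀ j < n + 1, S.f^[j] y ∈ S.domF) :
    ∃ v : List (Fin p), v.length = n + 2 ∧ y ∈ S.cyl v := by
  induction n generalizing y with
  | zero =>
    obtain ⟨i, z, hz, rfl⟩ := mem_iUnion.1 (hy 0 Nat.one_pos)
    obtain ⟨j, hj⟩ := mem_iUnion.1 hz
    exact ⟨[i, j], rfl, z, hj, rfl⟩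
  | succ n ih =>
    obtain ⟨i, z, hz, rfl⟩ := mem_iUnion.1 (hy 0 (Nat.succ_pos _))
    obtain ⟨v, hv, hzv⟩ := ih (y := z) fun j hj => by
      simpa [S.f_g i hz] using hy (j + 1) (by omega)
    refine ⟨i :: v, by simp [hv], ?_⟩
    rw [S.cyl_cons i (by rintro rfl; simp at hv)]
    exact ⟨z, hzv, rfl⟩

theorem subset_cyl_of_isPreconnected {B : Set ℝ} (hB : IsPreconnected B) {u : List (Fin p)}
    (hcov : ∀ y ∈ B, ∃ v : List (Fin p), v.length = u.length ∧ y ∈ S.cyl v) {x : ℝ}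
    (hx : x ∈ B) (hxu : x ∈ S.cyl u) : B ⊆ S.cyl u := by
  have hcl : IsClosed (⋃ v ∈ {v : List (Fin p) | v.length = u.length} \ {u}, S.cyl v) :=
    ((List.finite_length_eq (Fin p) _).sdiff).isClosed_biUnion fun v _ =>
      (S.isCompact_cyl v).isClosed
  have hdisj : Disjoint (S.cyl u)
      (⋃ v ∈ {v : List (Fin p) | v.length = u.length} \ {u}, S.cyl v) := by
    refine Set.disjoint_left.2 fun z hz hz' => ?_
    obtain ⟨v, hv, hzv⟩ := mem_iUnion₂.1 hz'
    exact hv.2 (S.eq_of_mem_cyl hv.1 hzv hz)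
  have hunion : B ⊆ S.cyl u ∪ ⋃ v ∈ {v : List (Fin p) | v.length = u.length} \ {u}, S.cyl v := by
    intro y hy
    obtain ⟨v, hv, hyv⟩ := hcov y hy
    by_cases hvu : v = u
    · exact Or.inl (hvu ▸ hyv)
    · exact Or.inr (mem_iUnion₂.2 ⟨v, ⟨hv, hvu⟩, hyv⟩)
  rcases isPreconnected_iff_subset_of_disjoint_closed.1 hB _ _
    (S.isCompact_cyl u).isClosed hcl hunion (by rw [hdisj.inter_eq, inter_empty]) with h | h
  · exact h
  · exact absurd (h hx) (Set.disjoint_left.1 hdisj hxu)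

theorem ball_subset_branch_image {ω : ℕ → Fin p} {x r : ℝ} (hω : S.IsCode ω x) {n : ℕ}
    (hn : n ≠ 0) (hr : 0 < r) (h : ∀ y ∈ ball x r, ∀ j < n, S.f^[j] y ∈ S.domF) :
    ball x r ⊆ S.branch (wordOf ω n) '' S.Isub (ω n) := by
  obtain ⟨m, rfl⟩ := Nat.exists_eq_succ_of_ne_zero hn
  have := S.subset_cyl_of_isPreconnected (convex_ball x r).isPreconnected
    (u := wordOf ω (m + 1 + 1)) (fun y hy => by
      obtain ⟨v, hv, hyv⟩ := S.exists_mem_cyl_of_iterate_mem_domF m (h y hy)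
      exact ⟨v, by rw [hv, length_wordOf], hyv⟩) (mem_ball_self hr) (hω _)
  rw [wordOf_add, S.cyl_append _ (wordOf_ne_nil _ one_ne_zero)] at this
  exact this

variable {S} {ν : Measure ℝ} {t : ℝ}

theorem IsConformal.exists_le_measure_cyl (hν : S.IsConformal ν t) (m : ℕ) :
    ∃ κ : ℝ, 0 < κ ∧ ∀ v : List (Fin p), v.length = m → (S.cyl v ∩ S.limitSet).Nonempty →
      ENNReal.ofReal κ ≤ ν (S.cyl v ∩ S.limitSet) := by
  set s := (List.finite_length_eq (Fin p) m).toFinset.filter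
    fun v => (S.cyl v ∩ S.limitSet).Nonempty with hs
  set κ := min 1 (s.inf fun v => ν (S.cyl v ∩ S.limitSet)) with hκ
  have hpos : 0 < κ := by
    refine lt_min one_pos ((Finset.lt_inf_iff ENNReal.zero_lt_top).2 fun v hv => ?_)
    exact hν.measure_cyl_pos (Finset.mem_filter.1 hv).2
  have htop : κ ≠ ⊤ := ne_top_of_le_ne_top ENNReal.one_ne_top (min_le_left _ _)
  refine ⟨κ.toReal, ENNReal.toReal_pos hpos.ne' htop, fun v hv hne => ?_⟩
  rw [ENNReal.ofReal_toReal htop]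
  exact (min_le_right _ _).trans (Finset.inf_le (by simp [hs, hv, hne]))

theorem IsConformal.exists_le_measure_closedBall (hν : S.IsConformal ν t) (ht : 0 ≤ t)
    {c₁ c₂ : ℝ} (hc₁ : 0 < c₁) (hc₂ : 0 < c₂) :
    ∃ c : ℝ, 0 < c ∧ ∀ x ∈ S.limitSet, ∀ n ≠ 0, ∀ r > 0,
      (∀ y ∈ ball x r, ∀ j < n, S.f^[j] y ∈ S.domF) →
      c₁ < Metric.diam (S.f^[n] '' ball x r) →
      (∀ y ∈ ball x r, ∀ z ∈ ball x r, |S.derIter n y| / |S.derIter n z| < c₂) →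
      ENNReal.ofReal (c * r ^ t) ≤ ν (closedBall x r) := by
  obtain ⟨aI, bI, habI, hI⟩ := S.hI
  obtain ⟨N, hN⟩ := S.hgen (c₁ / (4 * c₂ ^ 2)) (by positivity)
  set m := max N (S.forbLen + 1)
  obtain ⟨κ, hκ, hκν⟩ := hν.exists_le_measure_cyl m
  have hL : 0 < c₂ * (bI - aI) := mul_pos hc₂ (sub_pos.2 habI)
  refine ⟨κ / (c₂ * (bI - aI)) ^ t, by positivity, fun x hx n hn r hr hdom hdiam hdist => ?_⟩
  obtain ⟨ω, hω, hcode'⟩ := hx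
  have hcode : S.IsCode ω x := hcode'
  obtain ⟨a, b, hab, hIs⟩ := S.hIsub (ω n)
  have hIcc : Icc a b ⊆ S.dom := hIs ▸ S.Isub_subset_dom _
  have hba : b - a ≤ bI - aI := by
    have : Icc a b ⊆ Icc aI bI := hIs ▸ hI ▸ S.hsubI (ω n)
    have := (Icc_subset_Icc_iff hab.le).1 this
    linarith
  have hsub := S.ball_subset_branch_image hcode hn hr hdom
  rw [hIs] at hsub
  set G := S.branch (wordOf ω n)
  set G' := S.branchDer (wordOf ω n)
  have hit : ∀ Y ∈ S.dom, S.f^[n] (G Y) = Y := fun Y hY => by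
    simpa [length_wordOf] using S.iterate_f_branch (wordOf ω n) hY
  have hder : ∀ Y ∈ S.dom, S.derIter n (G Y) = (G' Y)⁻¹ := fun Y hY => by
    simpa [length_wordOf] using S.derIter_branch (wordOf ω n) hY
  have hG : ∀ Y ∈ Icc a b, HasDerivWithinAt G (G' Y) (Icc a b) Y := fun Y hY =>
    (S.hasDerivWithinAt_branch _ (hIcc hY)).mono hIcc
  have hG0 : ∀ Y ∈ Icc a b, G' Y ≠ 0 := fun Y hY => S.branchDer_ne_zero _ (hIcc hY)
  have hinj : InjOn G (Icc a b) := (S.injOn_branch _).mono hIcc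
  have himg : S.f^[n] '' ball x r = Icc a b ∩ G ⁻¹' ball x r := by
    ext Y
    constructor
    · rintro ⟨y, hy, rfl⟩
      obtain ⟨Y, hY, rfl⟩ := hsub hy
      rw [hit Y (hIcc hY)]
      exact ⟨hY, hy⟩
    · rintro ⟨hY, hYb⟩
      exact ⟨G Y, hYb, hit Y (hIcc hY)⟩
  rw [himg] at hdiam
  have hdist' : ∀ Y ∈ Icc a b ∩ G ⁻¹' ball x r, ∀ Z ∈ Icc a b ∩ G ⁻¹' ball x r,
      |G' Y| ≤ c₂ * |G' Z| := by
    intro Y hY Z hZ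
    have h := hdist (G Z) hZ.2 (G Y) hY.2
    rw [hder Z (hIcc hZ.1), hder Y (hIcc hY.1), abs_inv, abs_inv, div_inv_eq_mul, mul_comm,
      ← div_eq_mul_inv, div_lt_iff₀ (abs_pos.2 (hG0 Z hZ.1))] at h
    exact h.le
  set v := wordOf (fun k => ω (n + k)) m with hv
  have hm : S.forbLen + 1 ≤ m := le_max_right _ _
  have hvI : S.cyl v ⊆ Icc a b := by
    obtain ⟨m', hm'⟩ := Nat.exists_eq_succ_of_ne_zero (show m ≠ 0 by omega)
    rw [hv, hm', wordOf_succ, ← hIs]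
    exact S.cyl_cons_subset_Isub _ _
  have hXcode := hcode.iterate n
  have hXv : S.f^[n] x ∈ S.cyl v := hXcode m
  have hXx : G (S.f^[n] x) = x := hcode.branch_iterate n
  have hball : ∀ Y ∈ S.cyl v, Y ∈ Icc a b ∩ G ⁻¹' ball x r := fun Y hY =>
    ⟨hvI hY, mem_ball_of_close hG hG0 hinj hr hc₁ hc₂ hdiam hdist' (hvI hXv) hXx (hvI hY)
      (S.dist_lt_of_mem_cyl (hN v (by rw [hv, length_wordOf]; exact le_max_left _ _)) hY hXv)⟩
  have hXΛ : S.f^[n] x ∈ S.limitSet := ⟨_, avoids_shift hω n, hXcode⟩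
  have hκv := hκν v (by rw [hv, length_wordOf]) ⟨_, hXv, hXΛ⟩
  rw [hν.measure_cyl hω n (by omega)] at hκv
  have hmeas : MeasurableSet (G '' (S.cyl v ∩ S.limitSet)) :=
    (S.measurableSet_cyl_inter _).image_of_continuousOn_injOn
      ((S.continuousOn_branch _).mono (inter_subset_right.trans S.limitSet_subset_dom))
      ((S.injOn_branch _).mono (inter_subset_right.trans S.limitSet_subset_dom))
  have hbound : ENNReal.ofReal κ ≤
      ENNReal.ofReal ((c₂ * (bI - aI) / r) ^ t) * ν (closedBall x r) := by
    refine hκv.trans ?_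
    calc _ ≤ ∫⁻ _ in G '' (S.cyl v ∩ S.limitSet),
          ENNReal.ofReal ((c₂ * (bI - aI) / r) ^ t) ∂ν := by
          refine setLIntegral_mono' hmeas ?_
          rintro _ ⟨Y, hY, rfl⟩
          refine ENNReal.ofReal_le_ofReal (Real.rpow_le_rpow (abs_nonneg _) ?_ ht)
          have h1 := radius_le_deriv hG hinj hr hc₂ hsub hdist' (hball Y hY.1)
          have h2 : 0 < |G' Y| := abs_pos.2 (hG0 Y (hvI hY.1))
          rw [hder Y (hIcc (hvI hY.1)), abs_inv, le_div_iff₀ hr, inv_mul_le_iff₀ h2]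
          calc r ≤ c₂ * (b - a) * |G' Y| := h1
            _ ≤ c₂ * (bI - aI) * |G' Y| := by gcongr
            _ = _ := mul_comm _ _
      _ ≤ _ := by
          rw [setLIntegral_const]
          gcongr
          rintro _ ⟨Y, hY, rfl⟩
          exact ball_subset_closedBall (hball Y hY.1).2
  have hpos : 0 < (c₂ * (bI - aI) / r) ^ t := by positivity
  rw [mul_comm, ← ENNReal.div_le_iff_le_mul (Or.inl (by simpa using hpos))
    (Or.inl ENNReal.ofReal_ne_top), ← ENNReal.ofReal_div_of_pos hpos] at hbound
  convert hbound using 2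
  rw [Real.div_rpow hL.le hr.le]
  field_simp

theorem IsConformal.dimH_hypSet_le (hν : S.IsConformal ν t) (ht : 0 ≤ t) :
    dimH S.hypSet ≤ ENNReal.ofReal t := by
  have := hν.1
  refine dimH_le_of_frequently_closedBall_mass ν ht ?_
  rintro x ⟨hx, c₁, hc₁, c₂, hc₂, n, hn, r, hr, -, hr0, h⟩
  obtain ⟨c, hc, hball⟩ := hν.exists_le_measure_closedBall ht hc₁ hc₂
  refine ⟨c, hc, fun ε hε => ?_⟩
  obtain ⟨k, hk, hk1⟩ := ((hr0.eventually (gt_mem_nhds hε)).and (eventually_ge_atTop 1)).exists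
  obtain ⟨h1, h2, h3⟩ := h k
  have hnk : n k ≠ 0 := by
    have := hn.le_apply (x := k)
    omega
  exact ⟨r k, hr k, hk, hball x hx (n k) hnk (r k) (hr k) h1 h2 h3⟩

end ExpansiveMarkovSystem

/-! ### Eigenfunctionals of families of positive operators -/

section PositiveOperators

variable {X : Type*} [TopologicalSpace X] [CompactSpace X]

theorem ContinuousMap.le_norm_smul_one (h : C(X, ℝ)) : h ≤ ‖h‖ • (1 : C(X, ℝ)) := by
  intro x
  simpa using (le_abs_self _).trans (h.norm_coe_le_norm x)

theorem ContinuousMap.neg_norm_smul_one_le (h : C(X, ℝ)) : -(‖h‖ • (1 : C(X, ℝ))) ≤ h := by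
  intro x
  simpa using (abs_le.1 (h.norm_coe_le_norm x)).1

theorem ContinuousMap.norm_le_norm_of_nonneg_of_le {h k : C(X, ℝ)} (h0 : 0 ≤ h) (hk : h ≤ k) :
    ‖h‖ ≤ ‖k‖ := by
  refine (ContinuousMap.norm_le _ (norm_nonneg _)).2 fun x => ?_
  rw [Real.norm_of_nonneg (show 0 ≤ h x from h0 x)]
  exact (hk x).trans ((le_abs_self _).trans (k.norm_coe_le_norm x))

/-- A linear functional that is positive and normalized has norm at most one. -/
theorem abs_le_norm_of_positive {Φ : C(X, ℝ) →ₗ[ℝ] ℝ} (hΦ : ∀ h, 0 ≤ h → 0 ≤ Φ h)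
    (h1 : Φ 1 = 1) (h : C(X, ℝ)) : |Φ h| ≤ ‖h‖ := by
  have h2 := hΦ _ (sub_nonneg.2 h.le_norm_smul_one)
  have h3 := hΦ _ (sub_nonneg.2 h.neg_norm_smul_one_le)
  simp only [map_sub, map_neg, map_smul, h1, smul_eq_mul, mul_one] at h2 h3
  exact abs_le.2 ⟨by linarith, by linarith⟩

variable {T : C(X, ℝ) →L[ℝ] C(X, ℝ)}

theorem norm_apply_le_of_positive (hT : ∀ h, 0 ≤ h → 0 ≤ T h) (h : C(X, ℝ)) :
    ‖T h‖ ≤ ‖h‖ * ‖T 1‖ := by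
  refine (ContinuousMap.norm_le _ (by positivity)).2 fun x => ?_
  have h2 : (0 : C(X, ℝ)) x ≤ T (‖h‖ • 1 - h) x := hT _ (sub_nonneg.2 h.le_norm_smul_one) x
  have h3 : (0 : C(X, ℝ)) x ≤ T (h - -(‖h‖ • 1)) x :=
    hT _ (sub_nonneg.2 h.neg_norm_smul_one_le) x
  have h4 : T 1 x ≤ ‖T 1‖ := (le_abs_self _).trans ((T 1).norm_coe_le_norm x)
  have h5 : ‖h‖ * T 1 x ≤ ‖h‖ * ‖T 1‖ := by gcongr
  simp only [map_sub, map_neg, map_smul, ContinuousMap.zero_apply, ContinuousMap.sub_apply,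
    ContinuousMap.neg_apply, ContinuousMap.smul_apply, smul_eq_mul] at h2 h3
  rw [Real.norm_eq_abs]
  exact abs_le.2 ⟨by linarith, by linarith⟩

theorem pow_apply_nonneg (hT : ∀ h, 0 ≤ h → 0 ≤ T h) (n : ℕ) {h : C(X, ℝ)} (hh : 0 ≤ h) :
    0 ≤ (T ^ n) h := by
  induction n with
  | zero => simpa using hh
  | succ n ih => rw [pow_succ', mul_apply_eq_comp]; exact hT _ ih

theorem norm_pow_mul_apply_one_le (hT : ∀ h, 0 ≤ h → 0 ≤ T h) (n M : ℕ)
    (hn : ‖(T ^ n) 1‖ ≤ 1) : ‖(T ^ (n * M)) 1‖ ≤ 1 := by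
  induction M with
  | zero =>
    simp only [mul_zero, pow_zero, one_apply_eq_self]
    exact (ContinuousMap.norm_le _ zero_le_one).2 fun x => by simp
  | succ M ih =>
    rw [mul_add, mul_one, pow_add, mul_apply_eq_comp, ← one_mul (1 : ℝ)]
    have : T ^ (n * M) * T ^ n = T ^ n * T ^ (n * M) := by rw [← pow_add, ← pow_add, add_comm]
    rw [← mul_apply_eq_comp, this, mul_apply_eq_comp]
    exact (norm_apply_le_of_positive (fun h hh => pow_apply_nonneg hT n hh) _).trans (by gcongr)

theorem exists_lt_norm_sum_pow (hT : ∀ h, 0 ≤ h → 0 ≤ T h) (h1 : ∀ n, 1 ≤ ‖(T ^ n) 1‖) (C : ℝ) :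
    ∃ M : ℕ, C < ‖∑ j ∈ Finset.range M, (T ^ j) 1‖ := by
  by_contra! hC
  have hC0 : 0 ≤ C := (norm_nonneg _).trans (hC 0)
  have hone : (0 : C(X, ℝ)) ≤ 1 := fun x => zero_le_one
  have hle : ∀ j, (T ^ j) 1 ≤ C • (1 : C(X, ℝ)) := by
    intro j x
    have h2 : ‖(T ^ j) 1‖ ≤ C := by
      refine le_trans ?_ (hC (j + 1))
      refine ContinuousMap.norm_le_norm_of_nonneg_of_le (pow_apply_nonneg hT j hone) ?_
      exact Finset.single_le_sum (f := fun j => (T ^ j) (1 : C(X, ℝ)))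
        (fun i _ => pow_apply_nonneg hT i hone) (Finset.self_mem_range_succ j)
    simpa using (le_abs_self _).trans ((ContinuousMap.norm_coe_le_norm _ x).trans h2)
  have hsub : ∀ n j, (T ^ (n + j)) 1 ≤ C • (T ^ n) 1 := by
    intro n j
    have := pow_apply_nonneg hT n (sub_nonneg.2 (hle j))
    rw [map_sub, map_smul, ← mul_apply_eq_comp, ← pow_add] at this
    exact sub_nonneg.1 this
  obtain ⟨N, hN⟩ := exists_nat_gt (C * C)
  have hN0 : (0 : ℝ) < N := (mul_nonneg hC0 hC0).trans_lt hN
  have h2 : (N : ℝ) • (T ^ N) 1 ≤ C • ∑ j ∈ Finset.range N, (T ^ j) (1 : C(X, ℝ)) := by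
    have : ∑ j ∈ Finset.range N, (T ^ N) (1 : C(X, ℝ)) ≤
        ∑ j ∈ Finset.range N, C • (T ^ j) (1 : C(X, ℝ)) := by
      refine Finset.sum_le_sum fun j hj => ?_
      have := hsub j (N - j)
      rwa [Nat.add_sub_cancel' (Finset.mem_range.1 hj).le] at this
    rw [Finset.sum_const, Finset.card_range, ← Finset.smul_sum] at this
    rwa [Nat.cast_smul_eq_nsmul]
  have h3 := ContinuousMap.norm_le_norm_of_nonneg_of_le
    (smul_nonneg hN0.le (pow_apply_nonneg hT N hone)) h2
  rw [norm_smul, norm_smul, Real.norm_of_nonneg hN0.le, Real.norm_of_nonneg hC0] at h3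
  have h4 : (N : ℝ) * ‖(T ^ N) 1‖ ≤ C * C := h3.trans (by gcongr; exact hC N)
  nlinarith [h1 N]

theorem exists_approximate_eigenfunctional [Nonempty X] (hT : ∀ h, 0 ≤ h → 0 ≤ T h) {M : ℕ}
    {C : ℝ} (hC : 0 < C) (hM : C < ‖∑ j ∈ Finset.range M, (T ^ j) 1‖) {n : ℕ} (hn : ‖(T ^ n) 1‖ < 1) :
    ∃ Φ : C(X, ℝ) →ₗ[ℝ] ℝ, (∀ h, 0 ≤ h → 0 ≤ Φ h) ∧ Φ 1 = 1 ∧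
      ∀ h, |Φ (T h) - Φ h| ≤ 2 / C * ‖h‖ := by
  have hone : (0 : C(X, ℝ)) ≤ 1 := fun x => zero_le_one
  have hn0 : n ≠ 0 := by
    rintro rfl
    simp at hn
  set N := n * M with hN
  have hMN : M ≤ N := Nat.le_mul_of_pos_left M (Nat.pos_of_ne_zero hn0)
  have hTN : ‖(T ^ N) 1‖ ≤ 1 := norm_pow_mul_apply_one_le hT n M hn.le
  set R : C(X, ℝ) →L[ℝ] C(X, ℝ) := ∑ j ∈ Finset.range N, T ^ j with hR
  have hRpos : ∀ h, 0 ≤ h → 0 ≤ R h := by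
    intro h hh
    rw [hR, sum_apply]
    exact Finset.sum_nonneg fun j _ => pow_apply_nonneg hT j hh
  have hRC : C < ‖R 1‖ := by
    refine hM.trans_le (ContinuousMap.norm_le_norm_of_nonneg_of_le
      (Finset.sum_nonneg fun j _ => pow_apply_nonneg hT j hone) ?_)
    rw [hR, sum_apply]
    exact Finset.sum_le_sum_of_subset_of_nonneg (Finset.range_mono hMN)
      fun j _ _ => pow_apply_nonneg hT j hone
  obtain ⟨x, hx⟩ : ∃ x, C < R 1 x := by
    by_contra! h
    refine hRC.not_ge ((ContinuousMap.norm_le _ hC.le).2 fun x => ?_)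
    rw [Real.norm_of_nonneg (show 0 ≤ R 1 x from hRpos 1 hone x)]
    exact h x
  have hx0 : 0 < R 1 x := hC.trans hx
  refine ⟨(R 1 x)⁻¹ • ((ContinuousMap.evalCLM ℝ x).comp R).toLinearMap, fun h hh => ?_, ?_,
    fun h => ?_⟩
  · have := hRpos h hh x
    simp only [LinearMap.smul_apply, smul_eq_mul]
    exact mul_nonneg (inv_nonneg.2 hx0.le) this
  · simp only [LinearMap.smul_apply, smul_eq_mul]
    exact inv_mul_cancel₀ hx0.ne'
  · have htel : R (T h) - R h = (T ^ N) h - h := by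
      rw [hR, sum_apply, sum_apply,
        ← Finset.sum_sub_distrib]
      have := Finset.sum_range_sub (fun j => (T ^ j) h) N
      simpa [pow_succ] using this
    have hnorm : |R (T h) x - R h x| ≤ 2 * ‖h‖ := by
      rw [← ContinuousMap.sub_apply, htel]
      refine (ContinuousMap.norm_coe_le_norm ((T ^ N) h - h) x).trans ((norm_sub_le _ _).trans ?_)
      have := norm_apply_le_of_positive (fun h hh => pow_apply_nonneg hT N hh) h
      nlinarith [norm_nonneg h]
    have heq : ((R 1 x)⁻¹ • ((ContinuousMap.evalCLM ℝ x).comp R).toLinearMap) (T h) -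
        ((R 1 x)⁻¹ • ((ContinuousMap.evalCLM ℝ x).comp R).toLinearMap) h =
        (R (T h) x - R h x) / R 1 x := by
      simp only [LinearMap.smul_apply, smul_eq_mul]
      change (R 1 x)⁻¹ * R (T h) x - (R 1 x)⁻¹ * R h x = _
      field_simp
    rw [heq, abs_div, abs_of_pos hx0, div_mul_eq_mul_div]
    gcongr

theorem exists_eigenfunctional_of_approximate
    (happ : ∀ ε : ℝ, 0 < ε → ∃ Φ : C(X, ℝ) →ₗ[ℝ] ℝ, (∀ h, 0 ≤ h → 0 ≤ Φ h) ∧ Φ 1 = 1 ∧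
      ∀ h, |Φ (T h) - Φ h| ≤ ε * ‖h‖) :
    ∃ Φ : C(X, ℝ) →ₗ[ℝ] ℝ, (∀ h, 0 ≤ h → 0 ≤ Φ h) ∧ Φ 1 = 1 ∧ ∀ h, Φ (T h) = Φ h := by
  choose Ψ hpos hone hinv using fun k : ℕ => happ (1 / ((k : ℝ) + 1)) Nat.one_div_pos_of_nat
  have hK : IsCompact (Set.pi univ fun h : C(X, ℝ) => Icc (-‖h‖) ‖h‖) :=
    isCompact_univ_pi fun h => isCompact_Icc
  obtain ⟨φ, -, hφ⟩ := hK.ultrafilter_le_nhds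
    ((hyperfilter ℕ).map fun k => (fun h => Ψ k h : C(X, ℝ) → ℝ)) (by
      rw [Ultrafilter.coe_map, le_principal_iff]
      exact Filter.mem_map.2 (Eventually.of_forall fun k h _ => abs_le.1 (abs_le_norm_of_positive (hpos k) (hone k) h)))
  have hlim : ∀ h, Tendsto (fun k => Ψ k h) (hyperfilter ℕ : Filter ℕ) (nhds (φ h)) :=
    tendsto_pi_nhds.1 hφ
  refine ⟨⟨⟨φ, fun h k => ?_⟩, fun c h => ?_⟩, fun h hh => ?_, ?_, fun h => ?_⟩
  · refine tendsto_nhds_unique (hlim (h + k)) ?_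
    simpa using (hlim h).add (hlim k)
  · refine tendsto_nhds_unique (hlim (c • h)) ?_
    simpa using (hlim h).const_mul c
  · exact ge_of_tendsto' (hlim h) fun k => hpos k h hh
  · exact tendsto_nhds_unique (hlim 1) (by simp [hone])
  · change φ (T h) = φ h
    have h1 : Tendsto (fun k : ℕ => 1 / ((k : ℝ) + 1) * ‖h‖) (hyperfilter ℕ : Filter ℕ)
        (nhds 0) := by
      have := tendsto_one_div_add_atTop_nhds_zero_nat (𝕜 := ℝ)
      simpa using (this.mono_left Nat.hyperfilter_le_atTop).mul_const ‖h‖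
    have h2 := squeeze_zero_norm (a := fun k : ℕ => 1 / ((k : ℝ) + 1) * ‖h‖)
      (f := fun k => Ψ k (T h) - Ψ k h) (fun k => hinv k h) h1
    exact sub_eq_zero.1 (tendsto_nhds_unique ((hlim (T h)).sub (hlim h)) h2)

theorem exists_eigenfunctional [Nonempty X] {L : ℝ → C(X, ℝ) →L[ℝ] C(X, ℝ)}
    (hLu : ∀ s ε : ℝ, 0 < ε → ∀ᶠ u in nhds s, ∀ h, ‖L s h - L u h‖ ≤ ε * ‖h‖)
    (hL : ∀ h : ℝ → C(X, ℝ), Continuous h → Continuous fun s => L s (h s))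
    (hpos : ∀ s h, 0 ≤ h → 0 ≤ L s h) (h0 : ∀ n, 1 ≤ ‖(L 0 ^ n) 1‖)
    (h1 : ∃ n, ‖(L 1 ^ n) 1‖ < 1) :
    ∃ s ∈ Icc (0 : ℝ) 1, ∃ Φ : C(X, ℝ) →ₗ[ℝ] ℝ, (∀ h, 0 ≤ h → 0 ≤ Φ h) ∧ Φ 1 = 1 ∧
      ∀ h, Φ (L s h) = Φ h := by
  set A : Set ℝ := Icc 0 1 ∩ {s | ∀ n, 1 ≤ ‖(L s ^ n) 1‖} with hA
  have hpow : ∀ n, Continuous fun s => (L s ^ n) (1 : C(X, ℝ)) := by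
    intro n
    induction n with
    | zero => exact continuous_const
    | succ n ih =>
      simp only [pow_succ', mul_apply_eq_comp]
      exact hL _ ih
  have hAc : IsCompact A := by
    refine isCompact_Icc.inter_right ?_
    have : {s | ∀ n, 1 ≤ ‖(L s ^ n) 1‖} = ⋂ n, {s | 1 ≤ ‖(L s ^ n) 1‖} := by
      ext s
      simp
    rw [this]
    exact isClosed_iInter fun n => isClosed_le continuous_const (hpow n).norm
  have hAne : A.Nonempty := ⟨0, ⟨le_rfl, zero_le_one⟩, h0⟩
  obtain ⟨s, ⟨⟨hs0, hs1⟩, hsA⟩, hsup⟩ := hAc.exists_isGreatest hAne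
  have hslt : s < 1 := by
    refine hs1.lt_of_ne ?_
    rintro rfl
    obtain ⟨n, hn⟩ := h1
    exact hn.not_ge (hsA n)
  refine ⟨s, ⟨hs0, hs1⟩, exists_eigenfunctional_of_approximate fun ε hε => ?_⟩
  obtain ⟨M, hM⟩ := exists_lt_norm_sum_pow (hpos s) hsA (4 / ε)
  have hcont : Continuous fun u => ∑ j ∈ Finset.range M, (L u ^ j) 1 :=
    continuous_finsetSum _ fun j _ => hpow j
  have e1 : ∀ᶠ u in nhdsWithin s (Ioi s), 4 / ε < ‖∑ j ∈ Finset.range M, (L u ^ j) 1‖ :=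
    (hcont.norm.continuousAt.eventually (lt_mem_nhds hM)).filter_mono nhdsWithin_le_nhds
  have e2 : ∀ᶠ u in nhdsWithin s (Ioi s), ∀ h, ‖L s h - L u h‖ ≤ ε / 2 * ‖h‖ :=
    (hLu s (ε / 2) (by positivity)).filter_mono nhdsWithin_le_nhds
  have e3 : ∀ᶠ u in nhdsWithin s (Ioi s), u < 1 :=
    (gt_mem_nhds hslt).filter_mono nhdsWithin_le_nhds
  obtain ⟨u, hu1, hu2, hu3, hu4⟩ :=
    (e1.and (e2.and (e3.and self_mem_nhdsWithin))).exists
  have hu4' : s < u := hu4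
  obtain ⟨n, hn⟩ : ∃ n, ‖(L u ^ n) 1‖ < 1 := by
    by_contra! h
    exact hu4'.not_ge (hsup ⟨⟨hs0.trans hu4'.le, hu3.le⟩, h⟩)
  obtain ⟨Φ, hΦ, hΦ1, hΦL⟩ := exists_approximate_eigenfunctional (hpos u) (by positivity) hu1 hn
  refine ⟨Φ, hΦ, hΦ1, fun h => ?_⟩
  have h2 : |Φ (L s h) - Φ (L u h)| ≤ ε / 2 * ‖h‖ := by
    rw [← map_sub]
    exact (abs_le_norm_of_positive hΦ hΦ1 _).trans (hu2 h)
  have h3 := hΦL h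
  have h4 : 2 / (4 / ε) = ε / 2 := by
    field_simp
    norm_num
  rw [h4] at h3
  have h5 := abs_sub_le (Φ (L s h)) (Φ (L u h)) (Φ h)
  linarith

end PositiveOperators

/-! ### Weighted transfer operators -/

section Transfer

variable {X ι : Type*} [TopologicalSpace X] [CompactSpace X] [Fintype ι]

/-- The transfer operator `h ↦ ∑ i, a i * (h ∘ τ i)`. -/
noncomputable def transferOp (τ : ι → C(X, X)) (a : ι → C(X, ℝ)) : C(X, ℝ) →L[ℝ] C(X, ℝ) :=
  LinearMap.mkContinuous
    { toFun := fun h => ∑ i, a i * h.comp (τ i)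
      map_add' := fun h k => by
        simp only [ContinuousMap.add_comp, mul_add, Finset.sum_add_distrib]
      map_smul' := fun c h => by
        simp only [ContinuousMap.smul_comp, mul_smul_comm, Finset.smul_sum, RingHom.id_apply] }
    (∑ i, ‖a i‖) fun h => by
      refine (norm_sum_le _ _).trans ?_
      rw [Finset.sum_mul]
      refine Finset.sum_le_sum fun i _ => (norm_mul_le _ _).trans ?_
      gcongr
      exact (ContinuousMap.norm_le _ (norm_nonneg _)).2 fun x => h.norm_coe_le_norm _

theorem transferOp_eq (τ : ι → C(X, X)) (a : ι → C(X, ℝ)) (h : C(X, ℝ)) :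
    transferOp τ a h = ∑ i, a i * h.comp (τ i) := rfl

theorem transferOp_apply (τ : ι → C(X, X)) (a : ι → C(X, ℝ)) (h : C(X, ℝ)) (x : X) :
    transferOp τ a h x = ∑ i, a i x * h (τ i x) := by
  simp [transferOp_eq, ContinuousMap.sum_apply]

theorem transferOp_nonneg {τ : ι → C(X, X)} {a : ι → C(X, ℝ)} (ha : ∀ i x, 0 ≤ a i x)
    {h : C(X, ℝ)} (hh : 0 ≤ h) : 0 ≤ transferOp τ a h := by
  intro x
  change 0 ≤ transferOp τ a h x
  rw [transferOp_apply]
  exact Finset.sum_nonneg fun i _ => mul_nonneg (ha i x) (hh _)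

theorem exists_eigenfunctional_transferOp [Nonempty X] (τ : ι → C(X, X)) {a : ι → ℝ → C(X, ℝ)}
    (ha : ∀ i, Continuous (a i)) (hpos : ∀ i s x, 0 ≤ a i s x)
    (h0 : ∀ n, 1 ≤ ‖(transferOp τ (fun i => a i 0) ^ n) 1‖)
    (h1 : ∃ n, ‖(transferOp τ (fun i => a i 1) ^ n) 1‖ < 1) :
    ∃ s ∈ Icc (0 : ℝ) 1, ∃ Φ : C(X, ℝ) →ₗ[ℝ] ℝ, (∀ h, 0 ≤ h → 0 ≤ Φ h) ∧ Φ 1 = 1 ∧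
      ∀ h, Φ (transferOp τ (fun i => a i s) h) = Φ h := by
  refine exists_eigenfunctional (L := fun s => transferOp τ fun i => a i s)
    (fun s ε hε => ?_) (fun h hh => ?_) (fun s h hh => transferOp_nonneg (fun i => hpos i s) hh)
    h0 h1
  · have hc : Continuous fun u => ∑ i, ‖a i s - a i u‖ :=
      continuous_finsetSum _ fun i _ => (continuous_const.sub (ha i)).norm
    filter_upwards [hc.continuousAt.eventually_lt (continuousAt_const (y := ε))
      (by simpa using hε)] with u hu h
    rw [transferOp_eq, transferOp_eq, ← Finset.sum_sub_distrib]
    refine (norm_sum_le _ _).trans ?_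
    calc _ ≤ ∑ i, ‖a i s - a i u‖ * ‖h‖ := by
          refine Finset.sum_le_sum fun i _ => ?_
          rw [← sub_mul]
          refine (norm_mul_le _ _).trans ?_
          gcongr
          exact (ContinuousMap.norm_le _ (norm_nonneg _)).2 fun x => h.norm_coe_le_norm _
      _ ≤ ε * ‖h‖ := by
          rw [← Finset.sum_mul]
          gcongr
  · simp only [transferOp_eq]
    exact continuous_finsetSum _ fun i _ =>
      (ha i).mul ((ContinuousMap.continuous_precomp (τ i)).comp hh)

theorem transferOp_smul (τ : ι → C(X, X)) (a : ι → C(X, ℝ)) (c : ℝ) :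
    transferOp τ (fun i => c • a i) = c • transferOp τ a := by
  ext h x
  change transferOp τ (fun i => c • a i) h x = c * transferOp τ a h x
  rw [transferOp_apply, transferOp_apply, Finset.mul_sum]
  simp [mul_assoc]

end Transfer

namespace ExpansiveMarkovSystem

variable {p : ℕ} (S : ExpansiveMarkovSystem p)

/-! ### The transfer operators of the system -/

theorem exists_g_mem_limitSet {x : ℝ} (hx : x ∈ S.limitSet) : ∃ i, S.g i x ∈ S.limitSet := by
  obtain ⟨ω, hω, hc⟩ := hx
  have hc' : S.IsCode ω x := hc
  obtain ⟨ω', hω', h⟩ := S.hQinv ω hω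
  refine ⟨ω' 0, ω', hω', ?_⟩
  have := hc'.cons (ω' 0)
  rwa [seqCons_eq (funext h)] at this

theorem isClopen_g_mem_limitSet (i : Fin p) :
    IsClopen {x : S.limitSet | S.g i x ∈ S.limitSet} := by
  have hg : Continuous fun x : S.limitSet => S.g i x :=
    (S.continuousOn_g i).comp_continuous continuous_subtype_val
      fun x => S.limitSet_subset_dom x.2
  refine ⟨S.isClosed_limitSet.preimage hg, isOpen_iff_mem_nhds.2 fun x hx => ?_⟩
  obtain ⟨ω, hω, hc⟩ := hx
  have hc' : S.IsCode ω (S.g i x) := hc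
  have hxd := S.limitSet_subset_dom x.2
  have hi : ω 0 = i := S.eq_of_mem_Isub hc'.mem_Isub (S.g_mem_Isub i hxd)
  obtain ⟨U, hU, hUc⟩ := S.exists_isOpen_inter_limitSet (wordOf (fun k => ω (1 + k)) S.forbLen)
  have hxU : (x : ℝ) ∈ U := by
    refine (hUc.symm.subset ⟨?_, x.2⟩).1
    have := hc'.iterate 1 S.forbLen
    rwa [Function.iterate_one, S.f_g i hxd] at this
  filter_upwards [(hU.preimage continuous_subtype_val).mem_nhds hxU] with y hy
  have := S.branch_mem_limitSet hω 1 le_rfl y.2 (hUc.subset ⟨hy, y.2⟩).1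
  rw [wordOf_succ, hi] at this
  exact this

/-- The inverse branch `g i` on the limit set, extended by the identity. -/
noncomputable def invBranch (i : Fin p) : C(S.limitSet, S.limitSet) where
  toFun x := if h : S.g i x ∈ S.limitSet then ⟨S.g i x, h⟩ else x
  continuous_toFun := by
    refine continuous_induced_rng.2 ?_
    have : (Subtype.val ∘ fun x : S.limitSet =>
        if h : S.g i x ∈ S.limitSet then (⟨S.g i x, h⟩ : S.limitSet) else x) =
        fun x : S.limitSet => if S.g i x ∈ S.limitSet then S.g i x else x := by
      funext x
      by_cases h : S.g i x ∈ S.limitSet <;> simp [h]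
    rw [this]
    refine Continuous.if (fun x hx => ?_) ((S.continuousOn_g i).comp_continuous
      continuous_subtype_val fun x => S.limitSet_subset_dom x.2) continuous_subtype_val
    rw [(S.isClopen_g_mem_limitSet i).frontier_eq] at hx
    exact hx.elim

theorem coe_invBranch {i : Fin p} {x : S.limitSet} (h : S.g i x ∈ S.limitSet) :
    (S.invBranch i x : ℝ) = S.g i x := by
  simp [invBranch, h]

/-- The weight `|g i'| ^ s` of the inverse branch `g i` on the limit set. -/
noncomputable def weight (i : Fin p) : C(ℝ, C(S.limitSet, ℝ)) :=
  ContinuousMap.curry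
    { toFun := fun z : ℝ × S.limitSet =>
        if S.g i z.2 ∈ S.limitSet then |S.gder i z.2| ^ z.1 else 0
      continuous_toFun := by
        refine Continuous.if (fun z hz => ?_) (Continuous.rpow ?_ continuous_fst fun z =>
          Or.inl (abs_ne_zero.2 (S.hgder_ne i _ (S.limitSet_subset_dom z.2.2)))) continuous_const
        · have : IsClopen {z : ℝ × S.limitSet | S.g i z.2 ∈ S.limitSet} :=
            (S.isClopen_g_mem_limitSet i).preimage continuous_snd
          rw [this.frontier_eq] at hz
          exact hz.elim
        · exact ((S.hgder_cont i).comp_continuous (continuous_subtype_val.comp continuous_snd)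
            fun z => S.limitSet_subset_dom z.2.2).abs }

theorem weight_apply (i : Fin p) (s : ℝ) (x : S.limitSet) :
    S.weight i s x = if S.g i x ∈ S.limitSet then |S.gder i x| ^ s else 0 := rfl

theorem weight_nonneg (i : Fin p) (s : ℝ) (x : S.limitSet) : 0 ≤ S.weight i s x := by
  rw [weight_apply]
  split_ifs <;> positivity

instance : CompactSpace S.limitSet := isCompact_iff_compactSpace.1 S.isCompact_limitSet

theorem one_le_transferOp_zero_pow (n : ℕ) (x : S.limitSet) :
    1 ≤ (transferOp S.invBranch (fun i => S.weight i 0) ^ n) 1 x := by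
  induction n generalizing x with
  | zero => simp
  | succ n ih =>
    rw [pow_succ', mul_apply_eq_comp, transferOp_apply]
    obtain ⟨i, hi⟩ := S.exists_g_mem_limitSet x.2
    refine le_trans ?_ (Finset.single_le_sum (f := fun i => S.weight i 0 x *
      (transferOp S.invBranch (fun i => S.weight i 0) ^ n) 1 (S.invBranch i x))
      (fun j _ => mul_nonneg (S.weight_nonneg j 0 x) (zero_le_one.trans (ih _)))
      (Finset.mem_univ i))
    rw [weight_apply, if_pos hi, Real.rpow_zero, one_mul]
    exact ih _

end ExpansiveMarkovSystem

namespace ExpansiveMarkovSystem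

variable {p : ℕ} (S : ExpansiveMarkovSystem p)

/-! ### Subexponential growth of the sums of derivatives -/

/-- The sum of the absolute derivatives of all inverse branches of order `n`. -/
noncomputable def derSum : ℕ → ℝ → ℝ
  | 0 => fun _ => 1
  | n + 1 => fun x => ∑ i, |S.gder i x| * derSum n (S.g i x)

theorem derSum_nonneg (n : ℕ) (x : ℝ) : 0 ≤ S.derSum n x := by
  induction n generalizing x with
  | zero => exact zero_le_one
  | succ n ih => exact Finset.sum_nonneg fun i _ => mul_nonneg (abs_nonneg _) (ih _)

theorem continuousOn_derSum (n : ℕ) : ContinuousOn (S.derSum n) S.dom := by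
  induction n with
  | zero => exact continuousOn_const
  | succ n ih =>
    exact continuousOn_finsetSum _ fun i _ => (S.hgder_cont i).abs.mul
      (ih.comp (S.continuousOn_g i) fun x hx => S.g_mem_dom i hx)

theorem lintegral_derSum_le (n : ℕ) :
    ∫⁻ x in S.dom, ENNReal.ofReal (S.derSum n x) ≤ volume S.dom := by
  have hm : MeasurableSet S.dom := S.isCompact_dom.measurableSet
  induction n with
  | zero => simp [derSum]
  | succ n ih =>
    refine le_trans (le_of_eq ?_) ((lintegral_mono_set (s := ⋃ i, S.g i '' S.dom)
      (iUnion_subset fun i => ?_)).trans ih)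
    · have hmi : ∀ i, MeasurableSet (S.g i '' S.dom) := fun i =>
        (S.isCompact_dom.image_of_continuousOn (S.continuousOn_g i)).measurableSet
      have hd : Pairwise (Function.onFun Disjoint fun i => S.g i '' S.dom) := by
        intro i j hij
        refine Set.disjoint_left.2 ?_
        rintro _ ⟨x, hx, rfl⟩ ⟨y, hy, hxy⟩
        exact hij (S.eq_of_mem_Isub (S.g_mem_Isub i hx) (hxy ▸ S.g_mem_Isub j hy))
      rw [lintegral_iUnion hmi hd, tsum_fintype]
      calc _ = ∫⁻ x in S.dom, ∑ i, ENNReal.ofReal |S.gder i x| *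
            ENNReal.ofReal (S.derSum n (S.g i x)) := by
            refine lintegral_congr fun x => ?_
            rw [derSum, ENNReal.ofReal_sum_of_nonneg fun i _ =>
              mul_nonneg (abs_nonneg _) (S.derSum_nonneg _ _)]
            simp only [ENNReal.ofReal_mul (abs_nonneg _)]
        _ = ∑ i, ∫⁻ x in S.dom, ENNReal.ofReal |S.gder i x| *
            ENNReal.ofReal (S.derSum n (S.g i x)) := by
            refine lintegral_finsetSum' _ fun i _ => AEMeasurable.mul
              (f := fun x => ENNReal.ofReal |S.gder i x|) ?_ ?_
            · exact ENNReal.measurable_ofReal.comp_aemeasurable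
                ((S.hgder_cont i).abs.aemeasurable hm)
            · exact ENNReal.measurable_ofReal.comp_aemeasurable
                (((S.continuousOn_derSum n).comp (S.continuousOn_g i)
                  fun x hx => S.g_mem_dom i hx).aemeasurable hm)
        _ = _ := Finset.sum_congr rfl fun i _ =>
            (lintegral_image_eq_lintegral_abs_deriv_mul hm (S.hg_deriv i) (S.hg_inj i)
              fun y => ENNReal.ofReal (S.derSum n y)).symm
    · rintro _ ⟨x, hx, rfl⟩
      exact S.g_mem_dom i hx

theorem exists_log_lipschitz : ∃ θ : ℝ, 0 ≤ θ ∧ ∀ i, ∀ x ∈ S.dom, ∀ y ∈ S.dom,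
    |S.gder i x| ≤ Real.exp (θ * |x - y|) * |S.gder i y| := by
  choose θ hθ using S.hgder_lip
  refine ⟨∑ i, |θ i|, Finset.sum_nonneg fun i _ => abs_nonneg _, fun i x hx y hy => ?_⟩
  have hx0 := abs_pos.2 (S.hgder_ne i x hx)
  have hy0 := abs_pos.2 (S.hgder_ne i y hy)
  have h1 : θ i * |x - y| ≤ (∑ i, |θ i|) * |x - y| := by
    gcongr
    exact (le_abs_self _).trans
      (Finset.single_le_sum (f := fun i => |θ i|) (fun j _ => abs_nonneg _) (Finset.mem_univ i))
  have h2 := (le_abs_self _).trans (hθ i x hx y hy)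
  rw [← Real.log_le_log_iff hx0 (by positivity), Real.log_mul (Real.exp_ne_zero _) hy0.ne',
    Real.log_exp]
  linarith

theorem derSum_le_exp_mul {θ : ℝ} (hθ0 : 0 ≤ θ) (hθ : ∀ i, ∀ x ∈ S.dom, ∀ y ∈ S.dom,
    |S.gder i x| ≤ Real.exp (θ * |x - y|) * |S.gder i y|) {δ : ℕ → ℝ}
    (hδ : ∀ v : List (Fin p), ∀ x ∈ S.cyl v, ∀ y ∈ S.cyl v, |x - y| ≤ δ v.length) (n : ℕ)
    {v : List (Fin p)} (hv : v ≠ []) {x y : ℝ} (hx : x ∈ S.cyl v) (hy : y ∈ S.cyl v) :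
    S.derSum n x ≤
      Real.exp (∑ k ∈ Finset.range n, θ * δ (v.length + k)) * S.derSum n y := by
  induction n generalizing v x y with
  | zero => simp [derSum]
  | succ n ih =>
    simp only [derSum, Finset.mul_sum]
    refine Finset.sum_le_sum fun i _ => ?_
    have h1 := hθ i x (S.cyl_subset_dom hv hx) y (S.cyl_subset_dom hv hy)
    have h2 : S.derSum n (S.g i x) ≤ _ := ih (v := i :: v) (List.cons_ne_nil _ _)
      (by rw [S.cyl_cons i hv]; exact ⟨x, hx, rfl⟩) (by rw [S.cyl_cons i hv]; exact ⟨y, hy, rfl⟩)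
    have h3 : Real.exp (θ * |x - y|) ≤ Real.exp (θ * δ v.length) := by
      gcongr
      exact hδ v x hx y hy
    calc |S.gder i x| * S.derSum n (S.g i x)
        ≤ (Real.exp (θ * δ v.length) * |S.gder i y|) *
          (Real.exp (∑ k ∈ Finset.range n, θ * δ ((i :: v).length + k)) *
            S.derSum n (S.g i y)) := by
          refine mul_le_mul (h1.trans ?_) h2 (S.derSum_nonneg _ _) (by positivity)
          gcongr
      _ = _ := by
          rw [Finset.sum_range_succ', add_zero, Real.exp_add]
          simp only [List.length_cons, Nat.add_right_comm _ 1, Nat.add_assoc]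
          ring

theorem exists_derSum_le {η : ℝ} (hη : 0 < η) :
    ∃ K : ℝ, 0 < K ∧ ∀ n, ∀ x ∈ S.dom, S.derSum n x ≤ K * Real.exp (η * n) := by
  obtain ⟨θ, hθ0, hθ⟩ := S.exists_log_lipschitz
  obtain ⟨N, hN⟩ := S.hgen (η / (θ + 1)) (by positivity)
  set D := Metric.diam S.I
  have hD : 0 ≤ D := Metric.diam_nonneg
  set δ : ℕ → ℝ := fun k => (if k < N then D else 0) + η / (θ + 1) with hδdef
  have hδ : ∀ v : List (Fin p), ∀ x ∈ S.cyl v, ∀ y ∈ S.cyl v, |x - y| ≤ δ v.length := by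
    intro v x hx y hy
    simp only [hδdef]
    split_ifs with h
    · have : |x - y| ≤ D := Metric.dist_le_diam_of_mem S.isCompact_I.isBounded
        (S.cyl_subset_I v hx) (S.cyl_subset_I v hy)
      have : 0 < η / (θ + 1) := by positivity
      linarith
    · rw [zero_add]
      exact (S.dist_lt_of_mem_cyl (hN v (not_lt.1 h)) hx hy).le
  have hsum : ∀ n : ℕ, ∑ k ∈ Finset.range n, θ * δ (1 + k) ≤ θ * (N * D) + η * n := by
    intro n
    rw [← Finset.mul_sum]
    simp only [hδdef, Finset.sum_add_distrib, Finset.sum_const, Finset.card_range, nsmul_eq_mul]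
    have h1 : ∑ k ∈ Finset.range n, (if 1 + k < N then D else 0) ≤ N * D := by
      rw [← Finset.sum_filter, Finset.sum_const, nsmul_eq_mul]
      gcongr
      calc _ ≤ (Finset.range N).card := Finset.card_le_card fun k hk => by
            have := (Finset.mem_filter.1 hk).2
            exact Finset.mem_range.2 (by omega)
        _ = N := Finset.card_range N
    have h2 : θ * (n * (η / (θ + 1))) ≤ η * n := by
      have : θ / (θ + 1) ≤ 1 := (div_le_one (by positivity)).2 (by linarith)
      calc θ * (n * (η / (θ + 1))) = θ / (θ + 1) * (η * n) := by ring
        _ ≤ 1 * (η * n) := by gcongr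
        _ = _ := one_mul _
    rw [mul_add]
    gcongr
  have hvol : volume S.dom ≠ ⊤ := S.isCompact_dom.measure_ne_top
  have hvolj : ∀ j, 0 < volume.real (S.Isub j) := by
    intro j
    obtain ⟨a, b, hab, h⟩ := S.hIsub j
    rw [h, Real.volume_real_Icc_of_le hab.le]
    exact sub_pos.2 hab
  set V := ∑ j, volume.real S.dom / volume.real (S.Isub j)
  have hV : 0 ≤ V := Finset.sum_nonneg fun j _ => by positivity
  refine ⟨(V + 1) * Real.exp (θ * (N * D)), by positivity, fun n x hx => ?_⟩
  obtain ⟨j, hj⟩ := mem_iUnion.1 hx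
  have hle : ∀ y ∈ S.Isub j, S.derSum n x ≤ Real.exp (θ * (N * D) + η * n) * S.derSum n y := by
    intro y hy
    refine (S.derSum_le_exp_mul hθ0 hθ hδ n (List.cons_ne_nil j []) hj hy).trans ?_
    have := S.derSum_nonneg n y
    gcongr
    exact hsum n
  have hint : ENNReal.ofReal (S.derSum n x) * volume (S.Isub j) ≤
      ENNReal.ofReal (Real.exp (θ * (N * D) + η * n)) * volume S.dom := by
    rw [← setLIntegral_const]
    calc _ ≤ ∫⁻ y in S.Isub j, ENNReal.ofReal (Real.exp (θ * (N * D) + η * n)) *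
          ENNReal.ofReal (S.derSum n y) := by
          refine setLIntegral_mono' (S.isCompact_Isub j).measurableSet fun y hy => ?_
          rw [← ENNReal.ofReal_mul (Real.exp_nonneg _)]
          exact ENNReal.ofReal_le_ofReal (hle y hy)
      _ = ENNReal.ofReal (Real.exp (θ * (N * D) + η * n)) *
          ∫⁻ y in S.Isub j, ENNReal.ofReal (S.derSum n y) :=
          lintegral_const_mul' _ _ ENNReal.ofReal_ne_top
      _ ≤ _ := by
          gcongr
          exact (lintegral_mono_set (S.Isub_subset_dom j)).trans (S.lintegral_derSum_le n)
  have hreal : S.derSum n x * volume.real (S.Isub j) ≤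
      Real.exp (θ * (N * D) + η * n) * volume.real S.dom := by
    have := ENNReal.toReal_mono (by finiteness) hint
    simpa [Measure.real, ENNReal.toReal_mul, ENNReal.toReal_ofReal (S.derSum_nonneg n x),
      ENNReal.toReal_ofReal (Real.exp_nonneg _)] using this
  have hVj : volume.real S.dom / volume.real (S.Isub j) ≤ V + 1 := by
    have : volume.real S.dom / volume.real (S.Isub j) ≤ V :=
      Finset.single_le_sum (f := fun j => volume.real S.dom / volume.real (S.Isub j))
        (fun i _ => by positivity) (Finset.mem_univ j)
    linarith
  calc S.derSum n x ≤ Real.exp (θ * (N * D) + η * n) * volume.real S.dom /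
        volume.real (S.Isub j) := (le_div_iff₀ (hvolj j)).2 hreal
    _ = Real.exp (θ * (N * D) + η * n) * (volume.real S.dom / volume.real (S.Isub j)) :=
        mul_div_assoc _ _ _
    _ ≤ Real.exp (θ * (N * D) + η * n) * (V + 1) := by gcongr
    _ = _ := by rw [Real.exp_add]; ring

theorem transferOp_pow_one_le_derSum (n : ℕ) (x : S.limitSet) :
    (transferOp S.invBranch (fun i => S.weight i 1) ^ n) 1 x ≤ S.derSum n x := by
  induction n generalizing x with
  | zero => simp [derSum]
  | succ n ih =>
    rw [pow_succ', mul_apply_eq_comp, transferOp_apply, derSum]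
    refine Finset.sum_le_sum fun i _ => ?_
    rw [weight_apply]
    split_ifs with h
    · rw [Real.rpow_one, ← S.coe_invBranch h]
      gcongr
      exact ih _
    · rw [zero_mul]
      exact mul_nonneg (abs_nonneg _) (S.derSum_nonneg _ _)

theorem exists_norm_transferOp_pow_one_le {η : ℝ} (hη : 0 < η) :
    ∃ K : ℝ, 0 < K ∧ ∀ n : ℕ, ‖(transferOp S.invBranch (fun i => S.weight i 1) ^ n) 1‖ ≤
      K * Real.exp (η * n) := by
  obtain ⟨K, hK, h⟩ := S.exists_derSum_le hη
  refine ⟨K, hK, fun n => (ContinuousMap.norm_le _ (by positivity)).2 fun x => ?_⟩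
  have h0 : 0 ≤ (transferOp S.invBranch (fun i => S.weight i 1) ^ n) 1 x :=
    pow_apply_nonneg (fun h hh => transferOp_nonneg (fun i => S.weight_nonneg i 1) hh) n
      (fun _ => zero_le_one) x
  rw [Real.norm_of_nonneg h0]
  exact (S.transferOp_pow_one_le_derSum n x).trans (h n x (S.limitSet_subset_dom x.2))

theorem exists_conformal_functional [Nonempty S.limitSet] :
    ∃ t : ℝ, 0 ≤ t ∧ ∃ Φ : C(S.limitSet, ℝ) →ₗ[ℝ] ℝ, (∀ h, 0 ≤ h → 0 ≤ Φ h) ∧ Φ 1 = 1 ∧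
      ∀ h, Φ (transferOp S.invBranch (fun i => S.weight i t) h) = Φ h := by
  by_cases h1 : ∃ n, ‖(transferOp S.invBranch (fun i => S.weight i 1) ^ n) 1‖ < 1
  · obtain ⟨x₀⟩ := ‹Nonempty S.limitSet›
    obtain ⟨t, ht, h⟩ := exists_eigenfunctional_transferOp S.invBranch
      (a := fun i => S.weight i) (fun i => (S.weight i).continuous) S.weight_nonneg
      (fun n => (S.one_le_transferOp_zero_pow n x₀).trans
        ((le_abs_self _).trans (ContinuousMap.norm_coe_le_norm
          ((transferOp S.invBranch (fun i => S.weight i 0) ^ n) 1) x₀))) h1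
    exact ⟨t, ht.1, h⟩
  push Not at h1
  set T := transferOp S.invBranch (fun i => S.weight i 1) with hT
  have key : ∀ s : ℝ, 0 < s → ∃ n : ℕ, ‖(T ^ n) 1‖ < Real.exp (s * n) := by
    intro s hs
    obtain ⟨K, hK, h⟩ := S.exists_norm_transferOp_pow_one_le (half_pos hs)
    obtain ⟨n, hn⟩ := exists_nat_gt (K / (s / 2))
    refine ⟨n, (h n).trans_lt ?_⟩
    rw [div_lt_iff₀ (half_pos hs)] at hn
    have h2 : K < Real.exp (s / 2 * n) := by linarith [Real.add_one_le_exp (s / 2 * n)]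
    calc K * Real.exp (s / 2 * n) < Real.exp (s / 2 * n) * Real.exp (s / 2 * n) := by gcongr
      _ = Real.exp (s * n) := by rw [← Real.exp_add]; congr 1; ring
  have hsmul : ∀ s : ℝ, transferOp S.invBranch (fun i => Real.exp (-s) • S.weight i 1) =
      Real.exp (-s) • T := fun s => transferOp_smul _ _ _
  obtain ⟨s, hs, Φ, hΦ, hΦ1, hinv⟩ := exists_eigenfunctional_transferOp S.invBranch
    (a := fun i s => Real.exp (-s) • S.weight i 1)
    (fun i => (Real.continuous_exp.comp continuous_neg).smul continuous_const)
    (fun i s x => mul_nonneg (Real.exp_nonneg _) (S.weight_nonneg i 1 x))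
    (fun n => by
      rw [hsmul]
      simpa using h1 n)
    (by
      obtain ⟨n, hn⟩ := key 1 one_pos
      refine ⟨n, ?_⟩
      rw [hsmul, smul_pow, smul_apply, norm_smul,
        Real.norm_of_nonneg (by positivity), ← Real.exp_nat_mul]
      calc _ < Real.exp (n * -1) * Real.exp (1 * n) := by gcongr
        _ = 1 := by rw [← Real.exp_add]; simp)
  simp only [hsmul, smul_apply, map_smul, smul_eq_mul] at hinv
  have hinv' : ∀ h, Φ (T h) = Real.exp s * Φ h := by
    intro h
    rw [← hinv h, ← mul_assoc, ← Real.exp_add]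
    simp
  have hpow : ∀ n : ℕ, Φ ((T ^ n) 1) = Real.exp (s * n) := by
    intro n
    induction n with
    | zero => simp [hΦ1]
    | succ n ih =>
      rw [pow_succ', mul_apply_eq_comp, hinv', ih, ← Real.exp_add]
      congr 1
      push_cast
      ring
  have hs0 : s = 0 := by
    by_contra hne
    obtain ⟨n, hn⟩ := key s (lt_of_le_of_ne hs.1 (Ne.symm hne))
    have := abs_le_norm_of_positive hΦ hΦ1 ((T ^ n) 1)
    rw [hpow, abs_of_pos (Real.exp_pos _)] at this
    exact hn.not_ge this
  refine ⟨1, zero_le_one, Φ, hΦ, hΦ1, fun h => ?_⟩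
  rw [hinv', hs0, Real.exp_zero, one_mul]

end ExpansiveMarkovSystem

/-! ### Conformal measures from invariant functionals -/

/-- The Riesz representation theorem for positive functionals on a compact space. -/
theorem exists_measure_of_positive {X : Type*} [TopologicalSpace X] [CompactSpace X] [T2Space X]
    [MeasurableSpace X] [BorelSpace X] {Φ : C(X, ℝ) →ₗ[ℝ] ℝ} (hΦ : ∀ h, 0 ≤ h → 0 ≤ Φ h) :
    ∃ μ : Measure X, IsFiniteMeasure μ ∧ ∀ h : C(X, ℝ), ∫ x, h x ∂μ = Φ h := by
  let Λ : CompactlySupportedContinuousMap X ℝ →ₚ[ℝ] ℝ :=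
    { toFun := fun h => Φ h.toContinuousMap
      map_add' := fun h k => map_add Φ h.toContinuousMap k.toContinuousMap
      map_smul' := fun c h => map_smul Φ c h.toContinuousMap
      monotone' := fun h k hhk => by
        have := hΦ (k.toContinuousMap - h.toContinuousMap) fun x => sub_nonneg.2 (hhk x)
        rw [map_sub] at this
        exact sub_nonneg.1 this }
  refine ⟨RealRMK.rieszMeasure Λ, inferInstance, fun h => ?_⟩
  exact RealRMK.integral_rieszMeasure Λ ⟨h, HasCompactSupport.of_compactSpace _⟩

theorem lintegral_eq_of_transferOp_invariant {X ι : Type*} [TopologicalSpace X] [CompactSpace X]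
    [HasOuterApproxClosed X] [MeasurableSpace X] [BorelSpace X] [Fintype ι] {τ : ι → C(X, X)}
    {a : ι → C(X, ℝ)} (ha : ∀ i x, 0 ≤ a i x) {μ : Measure X} [IsFiniteMeasure μ]
    (hμ : ∀ h : C(X, ℝ), ∫ x, transferOp τ a h x ∂μ = ∫ x, h x ∂μ) {u : X → ENNReal}
    (hu : Measurable u) :
    ∫⁻ x, u x ∂μ = ∑ i, ∫⁻ x, ENNReal.ofReal (a i x) * u (τ i x) ∂μ := by
  have hint : ∀ h : C(X, ℝ), Integrable h μ := fun h =>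
    (BoundedContinuousFunction.mkOfCompact h).integrable μ
  have hm : ∀ i, Measurable fun x => ENNReal.ofReal (a i x) := fun i =>
    (a i).continuous.measurable.ennreal_ofReal
  have hfin : ∀ i, IsFiniteMeasure (μ.withDensity fun x => ENNReal.ofReal (a i x)) := fun i =>
    isFiniteMeasure_withDensity_ofReal (hint (a i)).2
  have hsum : μ = ∑ i, (μ.withDensity fun x => ENNReal.ofReal (a i x)).map (τ i) := by
    refine ext_of_forall_integral_eq_of_IsFiniteMeasure fun h => ?_
    have hh := hμ h.toContinuousMap
    change _ = ∫ x, h x ∂μ at hh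
    rw [← hh, integral_finsetSum_measure fun i _ => h.integrable _]
    simp only [transferOp_apply]
    refine (integral_finsetSum _ fun i _ =>
      hint (a i * h.toContinuousMap.comp (τ i))).trans ?_
    refine Finset.sum_congr rfl fun i _ => ?_
    rw [integral_map (τ i).continuous.aemeasurable h.continuous.aestronglyMeasurable,
      integral_withDensity_eq_integral_toReal_smul (hm i) (by simp)]
    refine integral_congr_ae (Eventually.of_forall fun x => ?_)
    simp only [ENNReal.toReal_ofReal (ha i x), smul_eq_mul]
    rfl
  conv_lhs => rw [hsum]
  rw [lintegral_finsetSum_measure]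
  refine Finset.sum_congr rfl fun i _ => ?_
  rw [lintegral_map hu (τ i).continuous.measurable]
  exact lintegral_withDensity_eq_lintegral_mul _ (hm i) (hu.comp (τ i).continuous.measurable)

namespace ExpansiveMarkovSystem

variable {p : ℕ} (S : ExpansiveMarkovSystem p)

/-- The preimage of `f '' A` in the limit set is the disjoint union of the preimages of `A` under
the inverse branches. -/
theorem indicator_image_f {A : Set ℝ} (hA : A ⊆ S.limitSet) (hinj : InjOn S.f A) (x : S.limitSet) :
    (S.f '' A).indicator (1 : ℝ → ENNReal) x =
      ∑ i, {y : S.limitSet | S.g i y ∈ A}.indicator 1 x := by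
  have hxd := S.limitSet_subset_dom x.2
  by_cases hx : (x : ℝ) ∈ S.f '' A
  · rw [indicator_of_mem hx]
    obtain ⟨y, hy, hyx⟩ := hx
    obtain ⟨ω, -, hc⟩ := hA hy
    have hc' : S.IsCode ω y := hc
    have hgy : S.g (ω 0) x = y := by rw [← hyx, hc'.g_f]
    rw [Finset.sum_eq_single (ω 0)]
    · have : x ∈ {y : S.limitSet | S.g (ω 0) y ∈ A} := mem_ofPred.2 (by rwa [hgy])
      rw [indicator_of_mem this]
      rfl
    · intro i _ hi
      refine indicator_of_notMem (fun h => hi ?_) _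
      have : S.g i x = y := hinj (mem_ofPred.1 h) hy (by rw [S.f_g i hxd, hyx])
      exact S.eq_of_mem_Isub (S.g_mem_Isub i hxd) (this ▸ hc'.mem_Isub)
    · simp
  · rw [indicator_of_notMem hx]
    refine (Finset.sum_eq_zero fun i _ => indicator_of_notMem (fun h => hx ?_) _).symm
    exact ⟨_, h, S.f_g i hxd⟩

theorem exists_isConformal [Nonempty S.limitSet] :
    ∃ t, 0 ≤ t ∧ ∃ ν : Measure ℝ, S.IsConformal ν t := by
  obtain ⟨t, ht, Φ, hΦ, hΦ1, hinv⟩ := S.exists_conformal_functional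
  obtain ⟨μ, hμfin, hμ⟩ := exists_measure_of_positive hΦ
  have hemb : MeasurableEmbedding (Subtype.val : S.limitSet → ℝ) :=
    MeasurableEmbedding.subtype_coe S.isClosed_limitSet.measurableSet
  have hinv' : ∀ u : S.limitSet → ENNReal, Measurable u → ∫⁻ x, u x ∂μ =
      ∑ i, ∫⁻ x, ENNReal.ofReal (S.weight i t x) * u (S.invBranch i x) ∂μ := fun u hu =>
    lintegral_eq_of_transferOp_invariant (fun i => S.weight_nonneg i t)
      (fun h => by rw [hμ, hμ, hinv]) hu
  refine ⟨t, ht, μ.map Subtype.val, ?_, ?_, fun A hA hAΛ hinj => ?_⟩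
  · have : IsProbabilityMeasure μ := by
      have h1 := hμ 1
      rw [hΦ1] at h1
      simp only [ContinuousMap.one_apply, integral_const, smul_eq_mul, mul_one] at h1
      exact ⟨(ENNReal.toReal_eq_one_iff _).1 h1⟩
    exact Measure.isProbabilityMeasure_map hemb.measurable.aemeasurable
  · rw [hemb.map_apply]
    simp
  · have hcont : Continuous fun x : S.limitSet => S.fder x :=
      S.continuousOn_fder_limitSet.domRestrict
    have hmeas : Measurable fun x : S.limitSet => ENNReal.ofReal (|S.fder x| ^ t) :=
      (hcont.measurable.abs.pow_const t).ennreal_ofReal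
    have hA' : MeasurableSet (Subtype.val ⁻¹' A : Set S.limitSet) := hemb.measurable hA
    have hgm : ∀ i, MeasurableSet {y : S.limitSet | S.g i y ∈ A} := fun i =>
      ((S.continuousOn_g i).comp_continuous continuous_subtype_val
        fun x => S.limitSet_subset_dom x.2).measurable hA
    rw [hemb.restrict_map, hemb.lintegral_map, ← lintegral_indicator hA',
      hinv' _ (hmeas.indicator hA'), hemb.map_apply]
    have hi : ∀ i x, ENNReal.ofReal (S.weight i t x) *
        (Subtype.val ⁻¹' A : Set S.limitSet).indicator
          (fun x => ENNReal.ofReal (|S.fder x| ^ t)) (S.invBranch i x) =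
        {y : S.limitSet | S.g i y ∈ A}.indicator 1 x := by
      intro i x
      have hxd := S.limitSet_subset_dom x.2
      rw [weight_apply]
      by_cases hx : S.g i x ∈ S.limitSet
      · rw [if_pos hx]
        simp only [indicator, mem_preimage, mem_ofPred_eq, S.coe_invBranch hx, Pi.one_apply]
        split_ifs
        · rw [← ENNReal.ofReal_mul (by positivity), S.hfder i x hxd, abs_inv,
            ← Real.mul_rpow (abs_nonneg _) (by positivity),
            mul_inv_cancel₀ (abs_ne_zero.2 (S.hgder_ne i x hxd)), Real.one_rpow,
            ENNReal.ofReal_one]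
        · simp
      · rw [if_neg hx, indicator_of_notMem (s := {y : S.limitSet | S.g i y ∈ A})
          fun h => hx (hAΛ (mem_ofPred.1 h))]
        simp
    simp only [hi]
    rw [← lintegral_finsetSum _ fun i _ => measurable_one.indicator (hgm i)]
    have hpre : (Subtype.val ⁻¹' (S.f '' A) : Set S.limitSet) =
        ⋃ i, {y : S.limitSet | S.g i y ∈ A} := by
      ext x
      simp only [mem_preimage, mem_iUnion, mem_ofPred_eq]
      constructor
      · rintro ⟨y, hy, hyx⟩
        obtain ⟨ω, -, hc⟩ := hAΛ hy
        have hc' : S.IsCode ω y := hc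
        exact ⟨ω 0, by rwa [← hyx, hc'.g_f]⟩
      · rintro ⟨i, h⟩
        exact ⟨_, h, S.f_g i (S.limitSet_subset_dom x.2)⟩
    rw [← lintegral_indicator_one (hpre ▸ MeasurableSet.iUnion hgm)]
    exact lintegral_congr fun x => S.indicator_image_f hAΛ hinj x

theorem dimH_hypSet_le_ofReal_tc : dimH S.hypSet ≤ ENNReal.ofReal S.tc := by
  rcases isEmpty_or_nonempty S.limitSet with h | h
  · have : S.hypSet = ∅ := eq_empty_of_forall_notMem fun x hx => h.elim ⟨x, hx.1⟩
    rw [this, dimH_empty]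
    exact zero_le
  · obtain ⟨t, ht, ν, hν⟩ := S.exists_isConformal
    have hfin : dimH S.hypSet ≠ ⊤ := ((hν.dimH_hypSet_le ht).trans_lt ENNReal.ofReal_lt_top).ne
    rw [← ENNReal.ofReal_toReal hfin]
    refine ENNReal.ofReal_le_ofReal (le_csInf ⟨t, ht, ν, hν⟩ ?_)
    rintro s ⟨hs, ν', hν'⟩
    exact ENNReal.toReal_le_of_le_ofReal hs (hν'.dimH_hypSet_le hs)

end ExpansiveMarkovSystem

/-- If `t ≥ 0` is such that a `t`-conformal measure exists, then
`dim_H H ≤ t`; consequently `dim_H H ≤ t_c`. -/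
theorem dimH_hypSet_le_tc {p : ℕ} (S : ExpansiveMarkovSystem p) :
    (∀ t : ℝ, 0 ≤ t → (∃ ν : Measure ℝ, S.IsConformal ν t) →
      dimH S.hypSet ≤ ENNReal.ofReal t) ∧
    dimH S.hypSet ≤ ENNReal.ofReal S.tc := by
  exact ⟨fun _ ht ⟨_, hν⟩ => hν.dimH_hypSet_le ht, S.dimH_hypSet_le_ofReal_tc⟩
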